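/- arXiv:2304.00922 — 5 statements merged into one kernel-verified Lean document; each statement's English description precedes it below -/
import Mathlib

section
/- Let n > 63. Then m(1,J(n,3)) = 4 if n is even; m(1,J(n,3)) = 6 if n is odd and n ≡ 0 or 6 (mod 9); and m(1,J(n,3)) = 7 if n is odd and n is not congruent to 0 or 6 modulo 9. -/
/-- `u` is `k`-feasible: coordinates sum to zero and the sum over every `k`-element
subset is a nonzero integer. -/
def KFeasible (n k : ℕ) (u : Fin n → ℝ) : Prop :=
  (∑ i, u i = 0) ∧
  ∀ A : Finset (Fin n), A.card = k → ∃ z : ℤ, z ≠ 0 ∧ ∑ i ∈ A, u i = z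

/-- `max_A |s_u(A)|` over the `k`-element subsets `A` of `Fin n`. -/
noncomputable def maxNormJ (n k : ℕ) (u : Fin n → ℝ) : ℝ :=
  ⨆ A : {A : Finset (Fin n) // A.card = k}, |∑ i ∈ A.1, u i|

/-- `m(1, J(n,k))`: infimum in `ℕ` of `1 + max_A |s_u(A)|` over `k`-feasible `u`. -/
noncomputable def mJ (n k : ℕ) : ℕ :=
  sInf {m : ℕ | ∃ u : Fin n → ℝ, KFeasible n k u ∧ (m : ℝ) = 1 + maxNormJ n k u}

lemma three_mem {n : ℕ} (p : Fin n → Prop) [DecidablePred p]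
    (h : (3 : ℤ) ≤ ∑ i, if p i then (1 : ℤ) else 0) :
    ∃ i j k, i ≠ j ∧ i ≠ k ∧ j ≠ k ∧ p i ∧ p j ∧ p k := by
  rw [Finset.sum_boole] at h
  have h' : 2 < (Finset.univ.filter p).card := by
    have : (3 : ℤ) ≤ ((Finset.univ.filter p).card : ℤ) := by simpa using h
    omega
  obtain ⟨a, ha, b, hb, c, hc, hab, hac, hbc⟩ := Finset.two_lt_card.1 h'
  simp only [Finset.mem_filter, Finset.mem_univ, true_and] at ha hb hc
  exact ⟨a, b, c, hab, hac, hbc, ha, hb, hc⟩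

lemma two_mem {n : ℕ} (p : Fin n → Prop) [DecidablePred p]
    (h : (2 : ℤ) ≤ ∑ i, if p i then (1 : ℤ) else 0) :
    ∃ i j, i ≠ j ∧ p i ∧ p j := by
  rw [Finset.sum_boole] at h
  have h' : 1 < (Finset.univ.filter p).card := by
    have : (2 : ℤ) ≤ ((Finset.univ.filter p).card : ℤ) := by simpa using h
    omega
  obtain ⟨a, ha, b, hb, hab⟩ := Finset.one_lt_card.1 h'
  simp only [Finset.mem_filter, Finset.mem_univ, true_and] at ha hb
  exact ⟨a, b, hab, ha, hb⟩

lemma one_mem {n : ℕ} (p : Fin n → Prop) [DecidablePred p]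
    (h : (1 : ℤ) ≤ ∑ i, if p i then (1 : ℤ) else 0) : ∃ i, p i := by
  by_contra hc
  push Not at hc
  simp [hc] at h

lemma cnt_nonneg {n : ℕ} (p : Fin n → Prop) [DecidablePred p] :
    (0 : ℤ) ≤ ∑ i, if p i then (1 : ℤ) else 0 :=
  Finset.sum_nonneg (fun i _ => by split_ifs <;> simp)

lemma even_of_odd {n : ℕ} (w : Fin n → ℤ) (hs : ∑ i, w i = 0) (h : ∀ i, w i % 2 = 1) :
    Even n := by
  have h1 : ∑ i, w i = ∑ i, (2 * (w i / 2) + 1) :=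
    Finset.sum_congr rfl (fun i _ => by have := h i; omega)
  rw [Finset.sum_add_distrib, ← Finset.mul_sum, hs] at h1
  simp at h1
  rw [Nat.even_iff]
  omega

lemma core_zero {n : ℕ} (hn : 63 < n) (w : Fin n → ℤ) (hs : ∑ i, w i = 0)
    (h : ∀ i j k, i ≠ j → i ≠ k → j ≠ k → w i + w j + w k ≠ 0 ∧ |w i + w j + w k| ≤ 5) :
    Even n ∧ ∃ i j k, i ≠ j ∧ i ≠ k ∧ j ≠ k ∧ 3 ≤ |w i + w j + w k| := by
  have h' : ∀ i j k, i ≠ j → i ≠ k → j ≠ k → w i + w j + w k ≠ 0 ∧ w i + w j + w k ≤ 5 ∧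
      -5 ≤ w i + w j + w k := fun i j k a b c => by
    have := h i j k a b c
    rw [abs_le] at this
    tauto
  have hL : ¬ (3 : ℤ) ≤ ∑ i, if 1 < w i then (1 : ℤ) else 0 := fun hc => by
    obtain ⟨i, j, k, a, b, c, x, y, z⟩ := three_mem _ hc
    have := h' i j k a b c
    omega
  have hS : ¬ (3 : ℤ) ≤ ∑ i, if w i < -1 then (1 : ℤ) else 0 := fun hc => by
    obtain ⟨i, j, k, a, b, c, x, y, z⟩ := three_mem _ hc
    have := h' i j k a b c
    omega
  have hZ : ¬ (3 : ℤ) ≤ ∑ i, if w i = 0 then (1 : ℤ) else 0 := fun hc => by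
    obtain ⟨i, j, k, a, b, c, x, y, z⟩ := three_mem _ hc
    have := h' i j k a b c
    omega
  have htot : (n : ℤ) = (∑ i, if 1 < w i then (1 : ℤ) else 0) + (∑ i, if w i < -1 then (1 : ℤ) else 0)
      + (∑ i, if w i = 0 then (1 : ℤ) else 0) + (∑ i, if w i = 1 then (1 : ℤ) else 0)
      + (∑ i, if w i = -1 then (1 : ℤ) else 0) := by
    simp only [← Finset.sum_add_distrib]
    rw [Finset.sum_congr rfl (g := fun _ => (1 : ℤ))]
    · simp
    · intro i _
      split_ifs <;> omega
  have pL := cnt_nonneg (fun i => 1 < w i)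
  have pS := cnt_nonneg (fun i => w i < -1)
  have hP : (3 : ℤ) ≤ ∑ i, if w i = 1 then (1 : ℤ) else 0 := by
    by_contra hc
    obtain ⟨a, b, hab, ha, hb⟩ := two_mem (fun i => w i = -1) (by omega)
    have hle : ∑ i, w i ≤ ∑ i, (7 * (if 1 < w i then (1 : ℤ) else 0) + (if w i = 1 then (1 : ℤ) else 0)
        - (if w i = -1 then (1 : ℤ) else 0)) := by
      apply Finset.sum_le_sum
      intro i _
      by_cases h1 : i = a
      · subst h1; simp [ha]
      by_cases h2 : i = b
      · subst h2; simp [hb]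
      have := h' i a b h1 h2 hab
      split_ifs <;> omega
    rw [Finset.sum_sub_distrib, Finset.sum_add_distrib, ← Finset.mul_sum] at hle
    omega
  have hN : (3 : ℤ) ≤ ∑ i, if w i = -1 then (1 : ℤ) else 0 := by
    by_contra hc
    obtain ⟨a, b, hab, ha, hb⟩ := two_mem (fun i => w i = 1) (by omega)
    have hle : ∑ i, ((if w i = 1 then (1 : ℤ) else 0)
        - (if w i = -1 then (1 : ℤ) else 0) - 7 * (if w i < -1 then (1 : ℤ) else 0)) ≤ ∑ i, w i := by
      apply Finset.sum_le_sum
      intro i _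
      by_cases h1 : i = a
      · subst h1; simp [ha]
      by_cases h2 : i = b
      · subst h2; simp [hb]
      have := h' i a b h1 h2 hab
      split_ifs <;> omega
    rw [Finset.sum_sub_distrib, Finset.sum_sub_distrib, ← Finset.mul_sum] at hle
    omega
  obtain ⟨a, b, c, hab, hac, hbc, ha, hb, hc⟩ := three_mem _ hP
  obtain ⟨d, e, f, hde, hdf, hef, hd, he, hf⟩ := three_mem _ hN
  refine ⟨even_of_odd w hs ?_, a, b, c, hab, hac, hbc, by rw [ha, hb, hc]; norm_num⟩
  intro i
  by_contra hi
  have e1 : i ≠ a := by rintro rfl; omega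
  have e2 : i ≠ b := by rintro rfl; omega
  have e3 : i ≠ d := by rintro rfl; omega
  have e4 : i ≠ e := by rintro rfl; omega
  have e5 : a ≠ d := by rintro rfl; omega
  have := h' i a b e1 e2 hab
  have := h' i d e e3 e4 hde
  have := h' i a d e1 e3 e5
  omega

lemma core_one {n : ℕ} (hn : 63 < n) (w : Fin n → ℤ) (hs : ∑ i, w i = 0)
    (hr : ∀ i, w i % 3 = 1)
    (h : ∀ i j k, i ≠ j → i ≠ k → j ≠ k → w i + w j + w k ≠ 0 ∧ |w i + w j + w k| ≤ 15) :
    (Even n ∨ n % 9 = 0 ∨ n % 9 = 6) ∧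
      ∃ i j k, i ≠ j ∧ i ≠ k ∧ j ≠ k ∧ 15 ≤ |w i + w j + w k| := by
  have h' : ∀ i j k, i ≠ j → i ≠ k → j ≠ k → w i + w j + w k ≠ 0 ∧ w i + w j + w k ≤ 15 ∧
      -15 ≤ w i + w j + w k := fun i j k a b c => by
    have := h i j k a b c
    rw [abs_le] at this
    tauto
  have hL : ¬ (3 : ℤ) ≤ ∑ i, if 5 < w i then (1 : ℤ) else 0 := fun hc => by
    obtain ⟨i, j, k, a, b, c, x, y, z⟩ := three_mem _ hc
    have := h' i j k a b c
    omega
  have hS : ¬ (3 : ℤ) ≤ ∑ i, if w i < -5 then (1 : ℤ) else 0 := fun hc => by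
    obtain ⟨i, j, k, a, b, c, x, y, z⟩ := three_mem _ hc
    have := h' i j k a b c
    omega
  have htot : (n : ℤ) = (∑ i, if 5 < w i then (1 : ℤ) else 0) + (∑ i, if w i < -5 then (1 : ℤ) else 0)
      + (∑ i, if w i = -5 then (1 : ℤ) else 0) + (∑ i, if w i = -2 then (1 : ℤ) else 0)
      + (∑ i, if w i = 1 then (1 : ℤ) else 0) + (∑ i, if w i = 4 then (1 : ℤ) else 0) := by
    simp only [← Finset.sum_add_distrib]
    rw [Finset.sum_congr rfl (g := fun _ => (1 : ℤ))]
    · simp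
    · intro i _
      have := hr i
      split_ifs <;> omega
  have pL := cnt_nonneg (fun i => 5 < w i)
  have pS := cnt_nonneg (fun i => w i < -5)
  have pA := cnt_nonneg (fun i => w i = -5)
  have pC := cnt_nonneg (fun i => w i = -2)
  have pD := cnt_nonneg (fun i => w i = 1)
  have pE := cnt_nonneg (fun i => w i = 4)
  -- lower bound on the sum given a uniform lower bound
  have low : ∀ t : ℤ, 0 ≤ t → (∀ i, -t ≤ w i) →
      (∑ i, if w i = 1 then (1 : ℤ) else 0) + 4 * (∑ i, if w i = 4 then (1 : ℤ) else 0)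
      - 5 * (∑ i, if w i = -5 then (1 : ℤ) else 0) - 2 * (∑ i, if w i = -2 then (1 : ℤ) else 0)
      - t * (∑ i, if w i < -5 then (1 : ℤ) else 0) ≤ 0 := by
    intro t ht hw
    refine le_of_le_of_eq ?_ hs
    simp only [Finset.mul_sum, ← Finset.sum_add_distrib, ← Finset.sum_sub_distrib]
    apply Finset.sum_le_sum
    intro i _
    have := hr i
    have := hw i
    split_ifs <;> omega
  have upp : (∀ i, w i ≤ 25) →
      0 ≤ (∑ i, if w i = 1 then (1 : ℤ) else 0) + 4 * (∑ i, if w i = 4 then (1 : ℤ) else 0)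
      - 5 * (∑ i, if w i = -5 then (1 : ℤ) else 0) - 2 * (∑ i, if w i = -2 then (1 : ℤ) else 0)
      + 25 * (∑ i, if 5 < w i then (1 : ℤ) else 0) := by
    intro hw
    refine le_of_eq_of_le hs.symm ?_
    simp only [Finset.mul_sum, ← Finset.sum_add_distrib, ← Finset.sum_sub_distrib]
    apply Finset.sum_le_sum
    intro i _
    have := hr i
    have := hw i
    split_ifs <;> omega
  by_cases hD : (2 : ℤ) ≤ ∑ i, if w i = 1 then (1 : ℤ) else 0
  · obtain ⟨a, b, hab, ha, hb⟩ := two_mem _ hD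
    have hC : ¬ (1 : ℤ) ≤ ∑ i, if w i = -2 then (1 : ℤ) else 0 := fun hc => by
      obtain ⟨i, hi⟩ := one_mem _ hc
      have e1 : i ≠ a := by rintro rfl; omega
      have e2 : i ≠ b := by rintro rfl; omega
      have := h' i a b e1 e2 hab
      omega
    have l := low 17 (by norm_num) (fun i => by
      by_cases e1 : i = a
      · subst e1; omega
      by_cases e2 : i = b
      · subst e2; omega
      have := h' i a b e1 e2 hab
      omega)
    have hA : (3 : ℤ) ≤ ∑ i, if w i = -5 then (1 : ℤ) else 0 := by omega
    obtain ⟨d, e, f, hde, hdf, hef, hd, he, hf⟩ := three_mem _ hA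
    refine ⟨Or.inl (even_of_odd w hs ?_), d, e, f, hde, hdf, hef, by rw [hd, he, hf]; norm_num⟩
    intro i
    by_contra hi
    have e1 : i ≠ a := by rintro rfl; omega
    have e2 : i ≠ b := by rintro rfl; omega
    have e3 : i ≠ d := by rintro rfl; omega
    have e4 : i ≠ e := by rintro rfl; omega
    have e5 : a ≠ d := by rintro rfl; omega
    have := h' i a b e1 e2 hab
    have := h' i d e e3 e4 hde
    have := h' i a d e1 e3 e5
    have := hr i
    omega
  by_cases hE : (2 : ℤ) ≤ ∑ i, if w i = 4 then (1 : ℤ) else 0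
  · obtain ⟨a, b, hab, ha, hb⟩ := two_mem _ hE
    have hC : ¬ (2 : ℤ) ≤ ∑ i, if w i = -2 then (1 : ℤ) else 0 := fun hc => by
      obtain ⟨i, j, hij, hi, hj⟩ := two_mem _ hc
      have e1 : i ≠ a := by rintro rfl; omega
      have e2 : j ≠ a := by rintro rfl; omega
      have := h' i j a hij e1 e2
      omega
    have l := low 23 (by norm_num) (fun i => by
      by_cases e1 : i = a
      · subst e1; omega
      by_cases e2 : i = b
      · subst e2; omega
      have := h' i a b e1 e2 hab
      omega)
    have hA : (3 : ℤ) ≤ ∑ i, if w i = -5 then (1 : ℤ) else 0 := by omega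
    obtain ⟨d, e, f, hde, hdf, hef, hd, he, hf⟩ := three_mem _ hA
    refine ⟨Or.inr ?_, d, e, f, hde, hdf, hef, by rw [hd, he, hf]; norm_num⟩
    have e5 : a ≠ d := by rintro rfl; omega
    have val : ∀ i, w i = -5 ∨ w i = 4 ∨ w i = -2 ∨ w i = 7 := by
      intro i
      by_contra hi
      have e1 : i ≠ a := by rintro rfl; omega
      have e2 : i ≠ b := by rintro rfl; omega
      have e3 : i ≠ d := by rintro rfl; omega
      have e4 : i ≠ e := by rintro rfl; omega
      have := h' i a b e1 e2 hab
      have := h' i d e e3 e4 hde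
      have := h' i a d e1 e3 e5
      have := hr i
      omega
    have hT : ¬ (2 : ℤ) ≤ ∑ i, if (w i = -2 ∨ w i = 7) then (1 : ℤ) else 0 := fun hc => by
      obtain ⟨i, j, hij, hi, hj⟩ := two_mem _ hc
      have e1 : i ≠ a := by rintro rfl; omega
      have e2 : j ≠ a := by rintro rfl; omega
      have e3 : i ≠ d := by rintro rfl; omega
      have e4 : j ≠ d := by rintro rfl; omega
      have := h' i j a hij e1 e2
      have := h' i j d hij e3 e4
      omega
    have hT2 : (∑ i, if (w i = -2 ∨ w i = 7) then (1 : ℤ) else 0) =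
        (∑ i, if w i = -2 then (1 : ℤ) else 0) + (∑ i, if w i = 7 then (1 : ℤ) else 0) := by
      rw [← Finset.sum_add_distrib]
      refine Finset.sum_congr rfl (fun i _ => ?_)
      split_ifs <;> omega
    have p7 := cnt_nonneg (fun i => w i = 7)
    have key : ∑ i, w i = (∑ i : Fin n, (4 : ℤ)) - 9 * (∑ i, if w i = -5 then (1 : ℤ) else 0)
        - 6 * (∑ i, if w i = -2 then (1 : ℤ) else 0) + 3 * (∑ i, if w i = 7 then (1 : ℤ) else 0) := by
      simp only [Finset.mul_sum, ← Finset.sum_add_distrib, ← Finset.sum_sub_distrib]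
      refine Finset.sum_congr rfl (fun i _ => ?_)
      have := val i
      split_ifs <;> omega
    rw [hs] at key
    simp only [Finset.sum_const, Finset.card_univ, Fintype.card_fin, nsmul_eq_mul] at key
    omega
  exfalso
  have u := upp (by
    by_cases hA : (2 : ℤ) ≤ ∑ i, if w i = -5 then (1 : ℤ) else 0
    · obtain ⟨a, b, hab, ha, hb⟩ := two_mem _ hA
      intro i
      by_cases e1 : i = a
      · subst e1; omega
      by_cases e2 : i = b
      · subst e2; omega
      have := h' i a b e1 e2 hab
      omega
    · obtain ⟨a, b, hab, ha, hb⟩ := two_mem (fun i => w i = -2) (by omega)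
      intro i
      by_cases e1 : i = a
      · subst e1; omega
      by_cases e2 : i = b
      · subst e2; omega
      have := h' i a b e1 e2 hab
      omega)
  omega

lemma exists_avoid {n : ℕ} (hn : 63 < n) (s : Finset (Fin n)) (hs : s.card ≤ 10) :
    ∃ x, x ∉ s := by
  by_contra hc
  push Not at hc
  have : s = Finset.univ := Finset.eq_univ_of_forall hc
  rw [this, Finset.card_univ, Fintype.card_fin] at hs
  omega

lemma core_int {n : ℕ} (hn : 63 < n) (w : Fin n → ℤ) (hs : ∑ i, w i = 0)
    (h : ∀ i j k, i ≠ j → i ≠ k → j ≠ k →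
      ∃ z : ℤ, w i + w j + w k = 3 * z ∧ z ≠ 0 ∧ |z| ≤ 5) :
    (Even n ∧ ∃ i j k, i ≠ j ∧ i ≠ k ∧ j ≠ k ∧ 9 ≤ |w i + w j + w k|) ∨
    ((Even n ∨ n % 9 = 0 ∨ n % 9 = 6) ∧
      ∃ i j k, i ≠ j ∧ i ≠ k ∧ j ≠ k ∧ 15 ≤ |w i + w j + w k|) := by
  have hcong : ∀ i j, w i % 3 = w j % 3 := by
    intro i j
    obtain ⟨a, ha⟩ := exists_avoid hn {i, j} (Finset.card_le_two.trans (by norm_num))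
    obtain ⟨b, hb⟩ := exists_avoid hn {i, j, a} (Finset.card_le_three.trans (by norm_num))
    simp only [Finset.mem_insert, Finset.mem_singleton, not_or] at ha hb
    obtain ⟨z, hz, -⟩ := h i a b (Ne.symm ha.1) (Ne.symm hb.1) (Ne.symm hb.2.2)
    obtain ⟨z', hz', -⟩ := h j a b (Ne.symm ha.2) (Ne.symm hb.2.1) (Ne.symm hb.2.2)
    omega
  have h15 : ∀ i j k, i ≠ j → i ≠ k → j ≠ k →
      w i + w j + w k ≠ 0 ∧ |w i + w j + w k| ≤ 15 := by
    intro i j k a b c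
    obtain ⟨z, hz, h0, h5⟩ := h i j k a b c
    rw [abs_le] at *
    omega
  let i0 : Fin n := ⟨0, by omega⟩
  have hcase : w i0 % 3 = 0 ∨ w i0 % 3 = 1 ∨ w i0 % 3 = 2 := by omega
  rcases hcase with h0 | h1 | h2
  · left
    have hd : ∀ i, w i = 3 * (w i / 3) := fun i => by have := hcong i i0; omega
    obtain ⟨he, i, j, k, a, b, c, hh⟩ := core_zero hn (fun i => w i / 3) (by
      have : ∑ i, w i = 3 * ∑ i, w i / 3 := by
        rw [Finset.mul_sum]; exact Finset.sum_congr rfl (fun i _ => hd i)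
      omega) (by
      intro i j k a b c
      have := h15 i j k a b c
      have := hd i
      have := hd j
      have := hd k
      rw [abs_le] at *
      omega)
    refine ⟨he, i, j, k, a, b, c, ?_⟩
    have := hd i
    have := hd j
    have := hd k
    rw [le_abs] at *
    omega
  · right
    exact core_one hn w hs (fun i => by have := hcong i i0; omega) h15
  · right
    obtain ⟨he, i, j, k, a, b, c, hh⟩ := core_one hn (fun i => - w i) (by simp [hs])
      (fun i => by have := hcong i i0; omega) (fun i j k a b c => by
        have := h15 i j k a b c
        rw [abs_le] at *
        omega)
    refine ⟨he, i, j, k, a, b, c, ?_⟩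
    rw [le_abs] at *
    omega

lemma sum_triple {n : ℕ} (u : Fin n → ℝ) {i j k : Fin n} (a : i ≠ j) (b : i ≠ k) (c : j ≠ k) :
    ∑ x ∈ ({i, j, k} : Finset (Fin n)), u x = u i + u j + u k := by
  rw [Finset.sum_insert (by simp [a, b]), Finset.sum_pair c]; ring

lemma le_maxNorm {n : ℕ} (u : Fin n → ℝ) {i j k : Fin n} (a : i ≠ j) (b : i ≠ k) (c : j ≠ k) :
    |u i + u j + u k| ≤ maxNormJ n 3 u := by
  rw [← sum_triple u a b c]
  exact le_ciSup (f := fun A : {A : Finset (Fin n) // A.card = 3} => |∑ i ∈ A.1, u i|)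
    (Set.finite_range _).bddAbove ⟨{i, j, k}, Finset.card_eq_three.2 ⟨i, j, k, a, b, c, rfl⟩⟩

lemma lower {n : ℕ} (hn : 63 < n) {m : ℕ} {u : Fin n → ℝ} (hu : KFeasible n 3 u)
    (hm : (m : ℝ) = 1 + maxNormJ n 3 u) :
    4 ≤ m ∧ (¬ Even n → 6 ≤ m) ∧ (¬ Even n → ¬ (n % 9 = 0 ∨ n % 9 = 6) → 7 ≤ m) := by
  by_cases hm7 : 7 ≤ m
  · exact ⟨by omega, fun _ => by omega, fun _ _ => hm7⟩
  have hm6 : (m : ℝ) ≤ 6 := by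
    have : m ≤ 6 := by omega
    exact_mod_cast this
  obtain ⟨hs, hu⟩ := hu
  have tri : ∀ i j k, i ≠ j → i ≠ k → j ≠ k → ∃ z : ℤ, z ≠ 0 ∧ u i + u j + u k = z := by
    intro i j k a b c
    rw [← sum_triple u a b c]
    exact hu _ (Finset.card_eq_three.2 ⟨i, j, k, a, b, c, rfl⟩)
  have hw : ∀ i, ∃ w : ℤ, 3 * u i = w := by
    intro i
    obtain ⟨j, hj⟩ := exists_avoid hn {i} (by simp)
    obtain ⟨k, hk⟩ := exists_avoid hn {i, j} (Finset.card_le_two.trans (by norm_num))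
    obtain ⟨l, hl⟩ := exists_avoid hn {i, j, k} (Finset.card_le_three.trans (by norm_num))
    simp only [Finset.mem_insert, Finset.mem_singleton, not_or] at hj hk hl
    obtain ⟨x, -, hx⟩ := tri i j k (Ne.symm hj) (Ne.symm hk.1) (Ne.symm hk.2)
    obtain ⟨y, -, hy⟩ := tri i j l (Ne.symm hj) (Ne.symm hl.1) (Ne.symm hl.2.1)
    obtain ⟨z, -, hz⟩ := tri i k l (Ne.symm hk.1) (Ne.symm hl.1) (Ne.symm hl.2.2)
    obtain ⟨t, -, ht⟩ := tri j k l (Ne.symm hk.2) (Ne.symm hl.2.1) (Ne.symm hl.2.2)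
    refine ⟨x + y + z - 2 * t, ?_⟩
    push_cast
    rw [← hx, ← hy, ← hz, ← ht]
    ring
  choose w hw using hw
  have conv : ∀ i j k, ((w i + w j + w k : ℤ) : ℝ) = 3 * (u i + u j + u k) := by
    intro i j k
    push_cast
    rw [← hw, ← hw, ← hw]; ring
  have bd : ∀ i j k, i ≠ j → i ≠ k → j ≠ k → |w i + w j + w k| ≤ 3 * ((m : ℤ) - 1) := by
    intro i j k a b c
    have h1 := le_maxNorm u a b c
    have h2 : ((|w i + w j + w k| : ℤ) : ℝ) ≤ ((3 * ((m : ℤ) - 1) : ℤ) : ℝ) := by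
      rw [Int.cast_abs, conv, abs_mul]
      push_cast
      rw [abs_of_pos (by norm_num : (0 : ℝ) < 3)]
      linarith
    exact_mod_cast h2
  have main := core_int hn w (by
      have : ((∑ i, w i : ℤ) : ℝ) = 0 := by
        push_cast
        simp only [← hw]
        rw [← Finset.mul_sum, hs, mul_zero]
      exact_mod_cast this) (by
    intro i j k a b c
    obtain ⟨z, hz, hz'⟩ := tri i j k a b c
    have h3 : w i + w j + w k = 3 * z := by
      have : ((w i + w j + w k : ℤ) : ℝ) = ((3 * z : ℤ) : ℝ) := by
        rw [conv, hz']; push_cast; ring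
      exact_mod_cast this
    refine ⟨z, h3, hz, ?_⟩
    have := bd i j k a b c
    rw [abs_le] at *
    omega)
  rcases main with ⟨he, i, j, k, a, b, c, hh⟩ | ⟨he, i, j, k, a, b, c, hh⟩
  · have := bd i j k a b c
    exact ⟨by omega, fun hx => absurd he hx, fun hx => absurd he hx⟩
  · have := bd i j k a b c
    exact ⟨by omega, fun hx => by omega, fun hx hy => by tauto⟩

lemma upper {n : ℕ} (M : ℕ) (w : ℕ → ℤ) (hs : ∑ i ∈ Finset.range n, w i = 0)
    (h : ∀ i j k, i < n → j < n → k < n → i ≠ j → i ≠ k → j ≠ k →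
      (w i + w j + w k) % 3 = 0 ∧ w i + w j + w k ≠ 0 ∧ w i + w j + w k ≤ 3 * M ∧
      -(3 * M) ≤ w i + w j + w k)
    (a b c : ℕ) (ha : a < n) (hb : b < n) (hc : c < n) (hab : a ≠ b) (hac : a ≠ c) (hbc : b ≠ c)
    (hM : w a + w b + w c = 3 * M ∨ w a + w b + w c = -(3 * M)) :
    ∃ u : Fin n → ℝ, KFeasible n 3 u ∧ ((M + 1 : ℕ) : ℝ) = 1 + maxNormJ n 3 u := by
  have conv : ∀ i j k : ℕ, ((w i : ℝ) / 3 + w j / 3 + w k / 3) = ((w i + w j + w k : ℤ) : ℝ) / 3 := by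
    intro i j k
    push_cast; ring
  refine ⟨fun i => (w i : ℝ) / 3, ⟨?_, ?_⟩, ?_⟩
  · rw [Fin.sum_univ_eq_sum_range (fun i => (w i : ℝ) / 3), ← Finset.sum_div]
    have : ((∑ i ∈ Finset.range n, w i : ℤ) : ℝ) = 0 := by rw [hs]; simp
    push_cast at this
    rw [this]; simp
  · intro A hA
    obtain ⟨i, j, k, h1, h2, h3, rfl⟩ := Finset.card_eq_three.1 hA
    have hh := h i j k i.2 j.2 k.2 (fun e => h1 (Fin.ext e)) (fun e => h2 (Fin.ext e))
      (fun e => h3 (Fin.ext e))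
    refine ⟨(w i + w j + w k) / 3, by omega, ?_⟩
    rw [sum_triple _ h1 h2 h3, conv]
    have : w i + w j + w k = 3 * ((w i + w j + w k) / 3) := by omega
    rw [div_eq_iff (by norm_num)]
    rw [mul_comm]
    exact_mod_cast this
  · have e : maxNormJ n 3 (fun i => (w i : ℝ) / 3) = M := by
      apply le_antisymm
      · haveI : Nonempty {A : Finset (Fin n) // A.card = 3} :=
          ⟨⟨{⟨a, ha⟩, ⟨b, hb⟩, ⟨c, hc⟩}, Finset.card_eq_three.2 ⟨_, _, _, by simpa using hab,
            by simpa using hac, by simpa using hbc, rfl⟩⟩⟩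
        apply ciSup_le
        rintro ⟨A, hA⟩
        obtain ⟨i, j, k, h1, h2, h3, rfl⟩ := Finset.card_eq_three.1 hA
        have hh := h i j k i.2 j.2 k.2 (fun e => h1 (Fin.ext e)) (fun e => h2 (Fin.ext e))
          (fun e => h3 (Fin.ext e))
        simp only
        rw [sum_triple _ h1 h2 h3, conv, abs_le]
        have x1 : ((w i + w j + w k : ℤ) : ℝ) ≤ 3 * M := by exact_mod_cast hh.2.2.1
        have x2 : -(3 * (M : ℝ)) ≤ ((w i + w j + w k : ℤ) : ℝ) := by exact_mod_cast hh.2.2.2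
        constructor <;> linarith
      · have := le_maxNorm (fun i : Fin n => (w i : ℝ) / 3) (i := ⟨a, ha⟩) (j := ⟨b, hb⟩)
          (k := ⟨c, hc⟩) (by simpa using hab) (by simpa using hac) (by simpa using hbc)
        refine le_trans ?_ this
        simp only
        rw [conv]
        rcases hM with hM | hM <;> rw [hM] <;> push_cast
        · exact le_trans (by linarith) (le_abs_self _)
        · exact le_trans (by linarith) (neg_le_abs _)
    rw [e]; push_cast; ring

lemma sum_step (a b c : ℕ) (x y z : ℤ) :
    ∑ i ∈ Finset.range (a + b + c), (if i < a then x else if i < a + b then y else z) =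
      a * x + b * y + c * z := by
  rw [Finset.sum_range_add, Finset.sum_range_add]
  have e1 : ∑ i ∈ Finset.range a, (if i < a then x else if i < a + b then y else z) =
      ∑ i ∈ Finset.range a, x := Finset.sum_congr rfl (fun i hi => by
    rw [Finset.mem_range] at hi; rw [if_pos hi])
  have e2 : ∑ i ∈ Finset.range b, (if a + i < a then x else if a + i < a + b then y else z) =
      ∑ i ∈ Finset.range b, y := Finset.sum_congr rfl (fun i hi => by
    rw [Finset.mem_range] at hi; rw [if_neg (by omega), if_pos (by omega)])
  have e3 : ∑ i ∈ Finset.range c, (if a + b + i < a then x else if a + b + i < a + b then y else z) =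
      ∑ i ∈ Finset.range c, z := Finset.sum_congr rfl (fun i hi => by
    rw [if_neg (by omega), if_neg (by omega)])
  rw [e1, e2, e3]
  simp

lemma upper' {n : ℕ} (M : ℕ) (p q r : ℕ) (x y z : ℤ) (hn : n = p + q + r)
    (hs : p * x + q * y + r * z = 0)
    (h : ∀ i j k, i < n → j < n → k < n → i ≠ j → i ≠ k → j ≠ k →
      ∀ s : ℤ, s = (if i < p then x else if i < p + q then y else z) +
        (if j < p then x else if j < p + q then y else z) +
        (if k < p then x else if k < p + q then y else z) →
      s % 3 = 0 ∧ s ≠ 0 ∧ s ≤ 3 * M ∧ -(3 * M) ≤ s)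
    (hp : 3 ≤ p)
    (hM : x + x + x = 3 * M ∨ x + x + x = -(3 * M) ∨ (0 < r ∧ x + x + z = 3 * M)) :
    ∃ u : Fin n → ℝ, KFeasible n 3 u ∧ ((M + 1 : ℕ) : ℝ) = 1 + maxNormJ n 3 u := by
  subst hn
  have hs' := (sum_step p q r x y z).trans hs
  have h0 : 0 < p := by omega
  have h1 : 1 < p := by omega
  have h2 : 2 < p := by omega
  rcases hM with hM | hM | ⟨hr, hM⟩
  · exact upper M _ hs' (fun i j k a b c d e f => h i j k a b c d e f _ rfl) 0 1 2 (by omega)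
      (by omega) (by omega) (by omega) (by omega) (by omega) (by simp [h0, h1, h2]; omega)
  · exact upper M _ hs' (fun i j k a b c d e f => h i j k a b c d e f _ rfl) 0 1 2 (by omega)
      (by omega) (by omega) (by omega) (by omega) (by omega) (by simp [h0, h1, h2]; omega)
  · exact upper M _ hs' (fun i j k a b c d e f => h i j k a b c d e f _ rfl) 0 1 (p + q) (by omega)
      (by omega) (by omega) (by omega) (by omega) (by omega) (by simp [h0, h1]; omega)

lemma mJ_eq {n m : ℕ} (h1 : ∃ u : Fin n → ℝ, KFeasible n 3 u ∧ (m : ℝ) = 1 + maxNormJ n 3 u)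
    (h2 : ∀ (m' : ℕ) (u : Fin n → ℝ), KFeasible n 3 u → (m' : ℝ) = 1 + maxNormJ n 3 u → m ≤ m') :
    mJ n 3 = m := by
  apply le_antisymm
  · exact Nat.sInf_le h1
  · refine le_csInf ⟨m, h1⟩ ?_
    rintro b ⟨u, hu, hb⟩
    exact h2 b u hu hb

theorem mJ_n_three (n : ℕ) (hn : 63 < n) :
    (Even n → mJ n 3 = 4) ∧
    (Odd n → (n % 9 = 0 ∨ n % 9 = 6) → mJ n 3 = 6) ∧
    (Odd n → ¬ (n % 9 = 0 ∨ n % 9 = 6) → mJ n 3 = 7) := by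
  refine ⟨fun he => ?_, fun ho h9 => ?_, fun ho h9 => ?_⟩
  · refine mJ_eq ?_ (fun m u hu hm => (lower hn hu hm).1)
    rw [Nat.even_iff] at he
    refine upper' 3 (n / 2) (n / 2) 0 3 (-3) 0 (by omega) (by push_cast; ring) ?_ (by omega)
      (by norm_num)
    intro i j k _ _ _ _ _ _ s hs
    split_ifs at hs <;> omega
  · refine mJ_eq ?_ (fun m u hu hm => (lower hn hu hm).2.1 (Nat.not_even_iff_odd.2 ho))
    rcases h9 with h9 | h9
    · refine upper' 5 (4 * (n / 9)) (5 * (n / 9)) 0 (-5) 4 0 (by omega) (by push_cast; ring) ?_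
        (by omega) (by norm_num)
      intro i j k _ _ _ _ _ _ s hs
      split_ifs at hs <;> omega
    · refine upper' 5 (4 * (n / 9) + 2) (5 * (n / 9) + 3) 1 (-5) 4 (-2) (by omega)
        (by push_cast; ring) ?_ (by omega) (by norm_num)
      intro i j k _ _ _ _ _ _ s hs
      split_ifs at hs <;> omega
  · refine mJ_eq ?_ (fun m u hu hm => (lower hn hu hm).2.2 (Nat.not_even_iff_odd.2 ho) h9)
    rw [Nat.odd_iff] at ho
    refine upper' 6 (n / 2 - 2) (n / 2 + 2) 1 3 (-3) 12 (by omega) ?_ ?_ (by omega)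
      (by norm_num)
    · omega
    · intro i j k _ _ _ _ _ _ s hs
      split_ifs at hs <;> omega
end

section
/- Let S be a Steiner triple system of order n with n > 7. (1) If n ≡ 1 (mod 4) then there exists u : Fin n → ℝ with ∑_i u(i) = 0 such that for every block T ∈ S, s_u(T) is a nonzero integer with |s_u(T)| ≤ 3 (hence m(1,Γ_S) ≤ 4). (2) If n ≡ 3 (mod 4) then there exists u : Fin n → ℝ with ∑_i u(i) = 0 such that for every block T ∈ S, s_u(T) is a nonzero integer with |s_u(T)| ≤ 4 (hence m(1,Γ_S) ≤ 5). -/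
/-- A Steiner triple system of order `n`. -/
def IsSTS (n : ℕ) (S : Finset (Finset (Fin n))) : Prop :=
  (∀ T ∈ S, T.card = 3) ∧
  (∀ p : Finset (Fin n), p.card = 2 → ∃! T, T ∈ S ∧ p ⊆ T)

theorem two_col {X : Type*} (s t : Equiv.Perm X) (hs : ∀ x, s (s x) = x) (ht : ∀ x, t (t x) = x)
    (fs : ∀ x, s x ≠ x) (ft : ∀ x, t x ≠ x) :
    ∃ v : X → ℤ, (∀ x, v x = 1 ∨ v x = -1) ∧ (∀ x, v (s x) = - v x) ∧ (∀ x, v (t x) = - v x) := by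
  classical
  have hs2 : s * s = 1 := by ext x; simp [hs]
  have ht2 : t * t = 1 := by ext x; simp [ht]
  have hsi : s⁻¹ = s := inv_eq_of_mul_eq_one_left hs2
  have hti : t⁻¹ = t := inv_eq_of_mul_eq_one_left ht2
  have ct : ∀ i : ℤ, t * (s * t) ^ i = (s * t) ^ (-i) * t := by
    intro i
    have h1 : t * (s * t) ^ i * t⁻¹ = (t * (s * t) * t⁻¹) ^ i := (conj_zpow).symm
    have h2 : t * (s * t) * t⁻¹ = (s * t)⁻¹ := by
      rw [mul_inv_rev, hsi]; simp [hti, mul_assoc, ht2]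
    rw [h2, inv_zpow, ← zpow_neg] at h1
    rw [← h1]; simp
  have cs : ∀ i : ℤ, s * (s * t) ^ i = (s * t) ^ (-i) * s := by
    intro i
    have h1 : s * (s * t) ^ i * s⁻¹ = (s * (s * t) * s⁻¹) ^ i := (conj_zpow).symm
    have h2 : s * (s * t) * s⁻¹ = (s * t)⁻¹ := by
      rw [mul_inv_rev, hsi, hti, ← mul_assoc s s t, hs2, one_mul]
    rw [h2, inv_zpow, ← zpow_neg] at h1
    rw [← h1]; simp
  have key : ∀ x, ¬ (s * t).SameCycle x (t x) := by
    rintro x ⟨j, hj⟩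
    rcases Int.even_or_odd' j with ⟨i, rfl | rfl⟩
    · apply ft (((s * t) ^ i) x)
      have := congrArg (fun f => f x) (ct i)
      simp only [Equiv.Perm.mul_apply] at this
      rw [this]
      change ((s * t) ^ (-i)) (t x) = _
      rw [← hj, ← Equiv.Perm.mul_apply, ← zpow_add]
      congr 2; ring
    · apply fs (((s * t) ^ (i+1)) x)
      have h1 : (s * ((s * t) ^ (i+1))) x = ((s * t) ^ (-(i+1)) * s) x := by rw [cs]
      have h2 : s x = (s * t) (t x) := by simp [ht]
      rw [Equiv.Perm.mul_apply, Equiv.Perm.mul_apply, h2, ← hj, ← Equiv.Perm.mul_apply,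
        ← Equiv.Perm.mul_apply] at h1
      refine h1.trans ?_
      rw [← Equiv.Perm.mul_apply]
      congr 1
      rw [mul_assoc]
      rw [← zpow_one_add, ← zpow_add]
      congr 1; ring
  let Q := Quotient (Equiv.Perm.SameCycle.setoid (s * t))
  let m : X → Q := fun x => Quotient.mk _ x
  have hm : ∀ x y, m x = m y ↔ (s * t).SameCycle x y := fun x y => Quotient.eq
  let _ : LinearOrder Q := linearOrderOfSTO WellOrderingRel
  have hne : ∀ x, m x ≠ m (t x) := fun x h => key x ((hm _ _).1 h)
  have h1 : ∀ x, m (s x) = m (t x) := by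
    intro x
    rw [eq_comm, hm]
    exact ⟨1, by simp [ht]⟩
  have h2 : ∀ x, m (t (s x)) = m x := by
    intro x
    rw [hm]
    exact ⟨1, by simp [ht, hs]⟩
  refine ⟨fun x => if m x < m (t x) then 1 else -1, ?_, ?_, ?_⟩
  · intro x; dsimp only; split_ifs <;> simp
  · intro x
    dsimp only
    rw [h1, h2]
    rcases lt_or_gt_of_ne (hne x) with h | h
    · simp [h, h.not_gt]
    · simp [h, h.not_gt]
  · intro x
    dsimp only
    rw [ht]
    rcases lt_or_gt_of_ne (hne x) with h | h
    · simp [h, h.not_gt]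
    · simp [h, h.not_gt]

theorem sts_inv {n : ℕ} {S : Finset (Finset (Fin n))} (hS : IsSTS n S) (p : Fin n) :
    ∃ s : Fin n → Fin n, (∀ x, s (s x) = x) ∧ s p = p ∧ (∀ x, x ≠ p → s x ≠ x ∧ s x ≠ p ∧
      ({p, x, s x} : Finset (Fin n)) ∈ S) ∧
      ∀ T ∈ S, p ∈ T → ∀ x ∈ T, x ≠ p → T = {p, x, s x} := by
  classical
  obtain ⟨h3, h2⟩ := hS
  have U : ∀ T ∈ S, ∀ T' ∈ S, ∀ x y, x ≠ y → x ∈ T → y ∈ T → x ∈ T' → y ∈ T' → T = T' := by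
    intro T hT T' hT' x y hxy a b c d
    refine (h2 {x, y} (Finset.card_pair hxy)).unique ⟨hT, ?_⟩ ⟨hT', ?_⟩ <;>
    · intro z hz
      simp only [Finset.mem_insert, Finset.mem_singleton] at hz
      rcases hz with rfl | rfl <;> assumption
  have E : ∀ x, ∃ y, (x = p → y = p) ∧ (x ≠ p → y ≠ x ∧ y ≠ p ∧ ({p, x, y} : Finset (Fin n)) ∈ S) := by
    intro x
    by_cases hx : x = p
    · exact ⟨p, fun _ => rfl, fun h => (h hx).elim⟩
    obtain ⟨T, ⟨hT, hs⟩, -⟩ := h2 {p, x} (Finset.card_pair (Ne.symm hx))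
    have hc : (T \ {p, x}).card = 1 := by
      rw [Finset.card_sdiff_of_subset hs, h3 T hT, Finset.card_pair (Ne.symm hx)]
    obtain ⟨y, hy⟩ := Finset.card_eq_one.1 hc
    have hy' : y ∈ T \ {p, x} := by rw [hy]; simp
    simp only [Finset.mem_sdiff, Finset.mem_insert, Finset.mem_singleton, not_or] at hy'
    refine ⟨y, fun h => (hx h).elim, fun _ => ⟨hy'.2.2, hy'.2.1, ?_⟩⟩
    have : T = {p, x, y} := by
      rw [← Finset.sdiff_union_of_subset hs, hy]
      ext z; simp; tauto
    rwa [← this]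
  choose s hs1 hs2 using E
  have F : ∀ T ∈ S, p ∈ T → ∀ x ∈ T, x ≠ p → T = {p, x, s x} := by
    intro T hT hp x hx hxp
    exact U T hT _ (hs2 x hxp).2.2 x p hxp hx hp (by simp) (by simp)
  refine ⟨s, ?_, hs1 p rfl, hs2, F⟩
  intro x
  by_cases hx : x = p
  · rw [hs1 x hx]; rw [hs1 p rfl, hx]
  obtain ⟨a, b, c⟩ := hs2 x hx
  have h := F _ c (by simp) (s x) (by simp) b
  have hxm : x ∈ ({p, s x, s (s x)} : Finset (Fin n)) := by rw [← h]; simp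
  simp only [Finset.mem_insert, Finset.mem_singleton] at hxm
  rcases hxm with h | h | h
  · exact (hx h).elim
  · exact (a h.symm).elim
  · exact h.symm

theorem case_one {n : ℕ} {S : Finset (Finset (Fin n))} (hS : IsSTS n S) (hn : n % 4 = 1) :
    ∃ u : Fin n → ℤ, (∑ i, u i = 0) ∧ ∀ T ∈ S, ∑ i ∈ T, u i ≠ 0 ∧ |∑ i ∈ T, u i| ≤ 3 := by
  classical
  let p : Fin n := ⟨0, by omega⟩
  obtain ⟨s, hs, hp, hne, hT⟩ := sts_inv hS p
  have hA : ∀ j, 2 * j + 1 ≤ n → ∃ A : Finset (Fin n), p ∉ A ∧ (∀ x ∈ A, s x ∈ A) ∧ A.card = 2 * j := by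
    intro j
    induction j with
    | zero => intro _; exact ⟨∅, by simp⟩
    | succ j ih =>
      intro h
      obtain ⟨A, h1, h2, h3⟩ := ih (by omega)
      have : ∃ x, x ∉ insert p A := by
        by_contra! hall
        have : insert p A = Finset.univ := Finset.eq_univ_iff_forall.2 hall
        have h4 := congrArg Finset.card this
        rw [Finset.card_insert_of_notMem h1, Finset.card_fin] at h4
        omega
      obtain ⟨x, hx⟩ := this
      simp only [Finset.mem_insert, not_or] at hx
      obtain ⟨a, b, c⟩ := hne x hx.1
      have hsx : s x ∉ A := fun h => hx.2 (by simpa [hs] using h2 _ h)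
      refine ⟨insert x (insert (s x) A), ?_, ?_, ?_⟩
      · simp [h1, Ne.symm hx.1, Ne.symm b]
      · intro y hy
        simp only [Finset.mem_insert] at hy ⊢
        rcases hy with rfl | rfl | hy
        · simp
        · simp [hs]
        · right; right; exact h2 _ hy
      · rw [Finset.card_insert_of_notMem, Finset.card_insert_of_notMem hsx, h3]
        · ring
        · simp [hx.2, Ne.symm a]
  obtain ⟨A, h1, h2, h3⟩ := hA (n / 4) (by omega)
  have h2' : ∀ x, s x ∈ A ↔ x ∈ A := fun x => ⟨fun h => by simpa [hs] using h2 _ h, h2 x⟩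
  let u : Fin n → ℤ := fun x => (if x = p then 1 else 0) + 2 * (if x ∈ A then 1 else 0) - 1
  have up : u p = 0 := by simp [u, h1]
  have uv : ∀ x, x ≠ p → u x = 1 ∨ u x = -1 := by
    intro x hx; simp only [u, if_neg hx]; split_ifs <;> simp
  have us : ∀ x, x ≠ p → u (s x) = u x := by
    intro x hx; simp only [u, if_neg hx, if_neg (hne x hx).2.1, h2']
  refine ⟨u, ?_, ?_⟩
  · simp only [u, Finset.sum_sub_distrib, Finset.sum_add_distrib, ← Finset.mul_sum]
    simp [h3]
    omega
  · intro T hTS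
    have h3T := hS.1 T hTS
    by_cases hpT : p ∈ T
    · obtain ⟨x, hx, hxp⟩ := Finset.exists_mem_ne (by omega : 1 < T.card) p
      rw [hT T hTS hpT x hx hxp]
      obtain ⟨a, b, c⟩ := hne x hxp
      rw [Finset.sum_insert (by simp [Ne.symm hxp, Ne.symm b]), Finset.sum_pair (Ne.symm a), up, us x hxp]
      rcases uv x hxp with h | h <;> rw [h] <;> norm_num
    · obtain ⟨x, y, z, hxy, hxz, hyz, rfl⟩ := Finset.card_eq_three.1 h3T
      simp only [Finset.mem_insert, Finset.mem_singleton, not_or] at hpT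
      rw [Finset.sum_insert (by simp [hxy, hxz]), Finset.sum_pair hyz]
      rcases uv x (Ne.symm hpT.1) with h | h <;> rcases uv y (Ne.symm hpT.2.1) with h' | h' <;>
        rcases uv z (Ne.symm hpT.2.2) with h'' | h'' <;> rw [h, h', h''] <;> norm_num

theorem case_two {n : ℕ} {S : Finset (Finset (Fin n))} (hS : IsSTS n S) (hn : 7 < n) :
    ∃ u : Fin n → ℤ, (∑ i, u i = 0) ∧ ∀ T ∈ S, ∑ i ∈ T, u i ≠ 0 ∧ |∑ i ∈ T, u i| ≤ 4 := by
  classical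
  let p : Fin n := ⟨0, by omega⟩
  let a : Fin n := ⟨1, by omega⟩
  have hap : a ≠ p := by simp [a, p]
  obtain ⟨s, hs, hsp, hsne, hsT⟩ := sts_inv hS p
  obtain ⟨t, ht, hta, htne, htT⟩ := sts_inv hS a
  obtain ⟨b, hb⟩ : ∃ b, b = s a := ⟨_, rfl⟩
  obtain ⟨hba, hbp, hblock⟩ := hsne a hap
  rw [← hb] at hba hbp hblock
  have htp : t p = b := by
    have h := htT _ hblock (by simp) p (by simp) hap.symm
    have : b ∈ ({a, p, t p} : Finset (Fin n)) := by rw [← h]; simp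
    simp only [Finset.mem_insert, Finset.mem_singleton] at this
    tauto
  have hsb : s b = a := by rw [hb, hs]
  have htb : t b = p := by rw [← htp, ht]
  let P : Fin n → Prop := fun x => x ≠ p ∧ x ≠ a ∧ x ≠ b
  have sP : ∀ x, P x → P (s x) := by
    rintro x ⟨h1, h2, h3⟩
    refine ⟨fun h => h1 ?_, fun h => h3 ?_, fun h => h2 ?_⟩
    · rw [← hs x, h, hsp]
    · rw [← hs x, h, hb]
    · rw [← hs x, h, hsb]
  have tP : ∀ x, P x → P (t x) := by
    rintro x ⟨h1, h2, h3⟩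
    refine ⟨fun h => h3 ?_, fun h => h2 ?_, fun h => h1 ?_⟩
    · rw [← ht x, h, htp]
    · rw [← ht x, h, hta]
    · rw [← ht x, h, htb]
  let s' : Equiv.Perm {x // P x} := ⟨fun x => ⟨s x, sP _ x.2⟩, fun x => ⟨s x, sP _ x.2⟩,
    fun x => by simp [hs], fun x => by simp [hs]⟩
  let t' : Equiv.Perm {x // P x} := ⟨fun x => ⟨t x, tP _ x.2⟩, fun x => ⟨t x, tP _ x.2⟩,
    fun x => by simp [ht], fun x => by simp [ht]⟩
  obtain ⟨c, hc, hcs, hct⟩ := two_col s' t' (fun x => by simp [s', hs]) (fun x => by simp [t', ht])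
    (fun x h => (hsne x x.2.1).1 (congrArg Subtype.val h))
    (fun x h => (htne x x.2.2.1).1 (congrArg Subtype.val h))
  let v : Fin n → ℤ := fun x => if h : P x then c ⟨x, h⟩ else 0
  have v0 : ∀ x, ¬ P x → v x = 0 := fun x h => by simp [v, h]
  have vp : v p = 0 := v0 _ (by simp [P])
  have va : v a = 0 := v0 _ (by simp [P])
  have vb : v b = 0 := v0 _ (by simp [P])
  have v1 : ∀ x, P x → v x = 1 ∨ v x = -1 := by
    intro x h; simp only [v, dif_pos h]; exact hc _
  have vs : ∀ x, P x → v (s x) = - v x := by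
    intro x h; simp only [v, dif_pos h, dif_pos (sP x h)]; exact hcs ⟨x, h⟩
  have vt : ∀ x, P x → v (t x) = - v x := by
    intro x h; simp only [v, dif_pos h, dif_pos (tP x h)]; exact hct ⟨x, h⟩
  have vs' : ∀ x, v (s x) = - v x := by
    intro x
    by_cases h : P x
    · exact vs x h
    · have : x = p ∨ x = a ∨ x = b := by by_contra! h'; exact h h'
      rcases this with rfl | rfl | rfl
      · rw [hsp, vp]; rfl
      · rw [← hb, vb, va]; rfl
      · rw [hsb, va, vb]; rfl
  have vsum : ∑ x, v x = 0 := by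
    have h : ∑ x, v (s x) = ∑ x, v x := Equiv.sum_comp (Function.Involutive.toPerm s hs) v
    simp only [vs', Finset.sum_neg_distrib] at h
    omega
  obtain ⟨d, hdP, hd⟩ : ∃ d, P d ∧ v d = -1 := by
    have : ∃ x, x ∉ ({p, a, b} : Finset (Fin n)) := by
      by_contra! hall
      have h4 := congrArg Finset.card (Finset.eq_univ_iff_forall.2 hall)
      rw [Finset.card_fin] at h4
      have := Finset.card_le_three (a := p) (b := a) (c := b)
      omega
    obtain ⟨x, hx⟩ := this
    have hx : P x := by simpa [P] using hx
    rcases v1 x hx with h | h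
    · exact ⟨s x, sP x hx, by rw [vs x hx, h]⟩
    · exact ⟨x, hx, h⟩
  let w : Fin n → ℤ := fun x => v x + (if x = p then 2 else 0) + (if x = a then -3 else 0)
    + (if x = b then -1 else 0) + (if x = d then 2 else 0)
  have wp : w p = 2 := by simp [w, vp, hap.symm, hbp.symm, hdP.1.symm]
  have wa : w a = -3 := by simp [w, va, hap, hba.symm, hdP.2.1.symm]
  have wb : w b = -1 := by simp [w, vb, hbp, hba, hdP.2.2.symm]
  have wx : ∀ x, P x → w x = v x ∨ (w x = 1 ∧ v x = -1) := by
    intro x hx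
    by_cases h : x = d
    · right; subst h; simp [w, hd, hx.1, hx.2.1, hx.2.2]
    · left; simp [w, h, hx.1, hx.2.1, hx.2.2]
  have w1 : ∀ x, P x → w x = 1 ∨ w x = -1 := by
    intro x hx
    have := wx x hx; have := v1 x hx; omega
  refine ⟨w, ?_, ?_⟩
  · simp only [w, Finset.sum_add_distrib, vsum]
    simp
  · intro T hTS
    have h3T := hS.1 T hTS
    by_cases hpT : p ∈ T
    · by_cases haT : a ∈ T
      · rw [hsT T hTS hpT a haT hap, ← hb, Finset.sum_insert (by simp [hap.symm, hbp.symm]),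
          Finset.sum_pair hba.symm, wp, wa, wb]
        norm_num
      · obtain ⟨x, hx, hxp⟩ := Finset.exists_mem_ne (by omega : 1 < T.card) p
        have hTe := hsT T hTS hpT x hx hxp
        have hP : P x := by
          refine ⟨hxp, fun h => haT (h ▸ hx), fun h => haT ?_⟩
          rw [hTe, h, hsb]; simp
        rw [hTe]
        obtain ⟨e, f, -⟩ := hsne x hxp
        rw [Finset.sum_insert (by simp [hxp.symm, f.symm]), Finset.sum_pair e.symm, wp]
        have := wx x hP; have := v1 x hP; have := vs x hP
        have := wx _ (sP x hP); have := v1 _ (sP x hP)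
        rw [abs_le]; omega
    · by_cases haT : a ∈ T
      · obtain ⟨x, hx, hxa⟩ := Finset.exists_mem_ne (by omega : 1 < T.card) a
        have hTe := htT T hTS haT x hx hxa
        have hP : P x := by
          refine ⟨fun h => hpT (h ▸ hx), hxa, fun h => hpT ?_⟩
          rw [hTe, h, htb]; simp
        rw [hTe]
        obtain ⟨e, f, -⟩ := htne x hxa
        rw [Finset.sum_insert (by simp [hxa.symm, f.symm]), Finset.sum_pair e.symm, wa]
        have := wx x hP; have := v1 x hP; have := vt x hP
        have := wx _ (tP x hP); have := v1 _ (tP x hP)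
        rw [abs_le]; omega
      · have w2 : ∀ x ∈ T, w x = 1 ∨ w x = -1 := by
          intro x hx
          by_cases h : x = b
          · right; rw [h, wb]
          · exact w1 x ⟨fun h => hpT (h ▸ hx), fun h => haT (h ▸ hx), h⟩
        obtain ⟨x, y, z, hxy, hxz, hyz, rfl⟩ := Finset.card_eq_three.1 h3T
        rw [Finset.sum_insert (by simp [hxy, hxz]), Finset.sum_pair hyz]
        have := w2 x (by simp); have := w2 y (by simp); have := w2 z (by simp)
        rw [abs_le]; omega

theorem to_real {n : ℕ} {S : Finset (Finset (Fin n))} (k : ℤ)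
    (h : ∃ u : Fin n → ℤ, (∑ i, u i = 0) ∧ ∀ T ∈ S, ∑ i ∈ T, u i ≠ 0 ∧ |∑ i ∈ T, u i| ≤ k) :
    ∃ u : Fin n → ℝ, (∑ i, u i = 0) ∧
        ∀ T ∈ S, ∃ z : ℤ, z ≠ 0 ∧ (∑ i ∈ T, u i) = z ∧ |∑ i ∈ T, u i| ≤ (k : ℝ) := by
  obtain ⟨u, h0, h⟩ := h
  refine ⟨fun i => (u i : ℝ), by dsimp only; exact_mod_cast h0, fun T hT => ⟨∑ i ∈ T, u i, (h T hT).1, by push_cast; rfl, ?_⟩⟩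
  dsimp only
  exact_mod_cast (h T hT).2

theorem sts_first_eigen_NZI_norm (n : ℕ) (hn : 7 < n)
    (S : Finset (Finset (Fin n))) (hS : IsSTS n S) :
    (n % 4 = 1 →
      ∃ u : Fin n → ℝ, (∑ i, u i = 0) ∧
        ∀ T ∈ S, ∃ z : ℤ, z ≠ 0 ∧ (∑ i ∈ T, u i) = z ∧ |∑ i ∈ T, u i| ≤ 3) ∧
    (n % 4 = 3 →
      ∃ u : Fin n → ℝ, (∑ i, u i = 0) ∧
        ∀ T ∈ S, ∃ z : ℤ, z ≠ 0 ∧ (∑ i ∈ T, u i) = z ∧ |∑ i ∈ T, u i| ≤ 4) := by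
  refine ⟨fun h => ?_, fun _ => ?_⟩
  · simpa using to_real 3 (case_one hS h)
  · simpa using to_real 4 (case_two hS hn)
end

section
/- Let r ≥ 4 and let X be the set of nonzero vectors of the vector space (Fin r → ZMod 2). Let S be the collection of all 3-element subsets {x,y,z} of X with x + y + z = 0 (the projective/Hamming Steiner triple system of order 2^r − 1, whose blocks are the supports of weight-three codewords of the Hamming code). Then: (1) S is a Steiner triple system on X; (2) S admits a 3-flow; and (3) S admits no 2-flow. (Equivalently, m(2,Γ_S) = 3.) -/
/-- The projective (Hamming) Steiner triple system of order `2^r - 1`: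
blocks are the 3-element sets `{x,y,z}` of nonzero vectors of `(Fin r → ZMod 2)`
with `x + y + z = 0`. -/
def hammingSTS (r : ℕ) : Finset (Finset (Fin r → ZMod 2)) :=
  Finset.univ.filter
    (fun T : Finset (Fin r → ZMod 2) =>
      T.card = 3 ∧ (∀ x ∈ T, x ≠ 0) ∧ ∑ x ∈ T, x = 0)

def hamTable : List (List ℤ) :=
  [[0, 0, 0, 0, 0, 0, 0, 0, 0, 0, 0, 0, 0, 0, 0, 0],
   [0, 0, 1, 1, 1, 1, 2, 2, -1, -1, -1, -1, -1, -1, -1, -1],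
   [0, 1, 0, 1, -1, -1, -1, -1, -1, -1, -1, -1, 2, 1, 2, 1],
   [0, 1, 1, 0, -1, -1, -1, -1, 1, 2, 2, 1, -1, -1, -1, -1],
   [0, 1, -1, -1, 0, 1, -1, -1, -1, -1, 1, 2, -1, -1, 1, 2],
   [0, 1, -1, -1, 1, 0, -1, -1, 2, 1, -1, -1, 1, 2, -1, -1],
   [0, 2, -1, -1, -1, -1, 0, 2, 1, 1, -1, -1, -1, -1, 1, 1],
   [0, 2, -1, -1, -1, -1, 2, 0, -1, -1, 1, 1, 1, 1, -1, -1],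
   [0, -1, -1, 1, -1, 2, 1, -1, 0, -1, -1, 1, -1, 2, 1, -1],
   [0, -1, -1, 2, -1, 1, 1, -1, -1, 0, 2, -1, 1, -1, -1, 1],
   [0, -1, -1, 2, 1, -1, -1, 1, -1, 2, 0, -1, -1, 1, 1, -1],
   [0, -1, -1, 1, 2, -1, -1, 1, 1, -1, -1, 0, 1, -1, -1, 2],
   [0, -1, 2, -1, -1, 1, -1, 1, -1, 1, -1, 1, 0, -1, 2, -1],
   [0, -1, 1, -1, -1, 2, -1, 1, 2, -1, 1, -1, -1, 0, -1, 1],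
   [0, -1, 2, -1, 1, -1, 1, -1, 1, -1, 1, -1, 2, -1, 0, -1],
   [0, -1, 1, -1, 2, -1, 1, -1, -1, 1, -1, 2, -1, 1, -1, 0]]

def hamEnc (x : Fin 4 → ZMod 2) : ℕ :=
  (x 0).val + 2 * (x 1).val + 4 * (x 2).val + 8 * (x 3).val

def hamBase (x y : Fin 4 → ZMod 2) : ℤ :=
  ((hamTable.getD (hamEnc x) []).getD (hamEnc y) 0)

/-- Symmetric-function form of a 3-flow. -/
def FlowP (V : Type) [AddCommGroup V] [Fintype V] : Prop :=
  ∃ g : V → V → ℤ, (∀ x y, g x y = g y x) ∧ (∀ x y, g x (x + y) = g x y) ∧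
    (∀ x y, g x y = 0 ↔ (x = 0 ∨ y = 0 ∨ x = y)) ∧ (∀ x y, |g x y| ≤ 2) ∧
    ∀ x, ∑ y, g x y = 0

def WeightP (V : Type) [AddCommGroup V] [Fintype V] : Prop :=
  ∃ w : V → V → ℤ, (∀ x a, w x (x + a) = w x a) ∧
    (∀ x a, w x a = 0 ↔ x = 0) ∧ (∀ x a, |w x a| ≤ 2) ∧
    (∀ x, ∑ a, w x a = 0) ∧ ∀ a, ∑ x, w x a = 0

theorem flowP_base : FlowP (Fin 4 → ZMod 2) := by
  refine ⟨hamBase, ?_, ?_, ?_, ?_, ?_⟩ <;> decide +kernel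

theorem flowP_equiv {V W : Type} [AddCommGroup V] [Fintype V] [AddCommGroup W] [Fintype W]
    (e : V ≃+ W) (h : FlowP W) : FlowP V := by
  obtain ⟨g, h1, h2, h3, h4, h5⟩ := h
  refine ⟨fun x y => g (e x) (e y), fun x y => h1 _ _, fun x y => ?_, fun x y => ?_,
    fun x y => h4 _ _, fun x => ?_⟩
  · simp only [map_add]; exact h2 _ _
  · simp [h3]
  · exact (e.toEquiv.sum_comp (fun y => g (e x) y)).trans (h5 _)

theorem weightP_equiv {V W : Type} [AddCommGroup V] [Fintype V] [AddCommGroup W] [Fintype W]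
    (e : V ≃+ W) (h : WeightP W) : WeightP V := by
  obtain ⟨g, h2, h3, h4, h5, h6⟩ := h
  refine ⟨fun x y => g (e x) (e y), fun x y => ?_, fun x y => ?_,
    fun x y => h4 _ _, fun x => ?_, fun x => ?_⟩
  · simp only [map_add]; exact h2 _ _
  · simp [h3]
  · exact (e.toEquiv.sum_comp (fun y => g (e x) y)).trans (h5 _)
  · exact (e.toEquiv.sum_comp (fun y => g y (e x))).trans (h6 _)

def consAdd (n : ℕ) : (Fin (n + 1) → ZMod 2) ≃+ ZMod 2 × (Fin n → ZMod 2) where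
  toFun x := (x 0, fun i => x i.succ)
  invFun p := Fin.cons p.1 p.2
  left_inv x := by
    funext i
    refine Fin.cases ?_ (fun j => ?_) i <;> simp
  right_inv p := by simp
  map_add' x y := by
    ext <;> simp

theorem zcases (i : ZMod 2) : i = 0 ∨ i = 1 := by
  revert i; decide

theorem sumZ (f : ZMod 2 → ℤ) : ∑ i, f i = f 0 + f 1 := Fin.sum_univ_two f

theorem one_add_one_z : (1 : ZMod 2) + 1 = 0 := by decide

theorem flowP_step {V : Type} [AddCommGroup V] [Fintype V] (h2V : ∀ x : V, x + x = 0)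
    (hf : FlowP V) (hw : WeightP V) : FlowP (ZMod 2 × V) := by
  obtain ⟨g, g1, g2, g3, g4, g5⟩ := hf
  obtain ⟨w, w1, w2, w3, w4, w5⟩ := hw
  have ee : ∀ x y : V, x + y = 0 ↔ x = y := fun x y => by
    constructor
    · intro h
      have := congrArg (· + y) h
      simpa [add_assoc, h2V] using this
    · rintro rfl; exact h2V x
  refine ⟨fun p q => if p.1 = 0 then (if q.1 = 0 then g p.2 q.2 else w p.2 q.2)
      else (if q.1 = 0 then w q.2 p.2 else w (p.2 + q.2) p.2), ?_, ?_, ?_, ?_, ?_⟩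
  · rintro ⟨i, x⟩ ⟨j, y⟩
    rcases zcases i with rfl | rfl <;> rcases zcases j with rfl | rfl <;> simp
    · exact g1 _ _
    · rw [← w1 (x + y) x, add_comm y x]
      congr 1
      rw [add_right_comm, h2V, zero_add]
  · rintro ⟨i, x⟩ ⟨j, y⟩
    rcases zcases i with rfl | rfl <;> rcases zcases j with rfl | rfl <;>
      simp [g2, w1, one_add_one_z]
    rw [← add_assoc, h2V, zero_add]
  · rintro ⟨i, x⟩ ⟨j, y⟩
    rcases zcases i with rfl | rfl <;> rcases zcases j with rfl | rfl <;>
      simp [g3, w2, ee]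
  · rintro ⟨i, x⟩ ⟨j, y⟩
    rcases zcases i with rfl | rfl <;> rcases zcases j with rfl | rfl <;>
      simp [g4, w3]
  · rintro ⟨i, x⟩
    rw [Fintype.sum_prod_type, sumZ]
    rcases zcases i with rfl | rfl
    · simp [g5, w4]
    · have := Equiv.sum_comp (Equiv.addLeft x) (fun z => w z x)
      simp only [Equiv.coe_addLeft] at this
      simp [w5, this]

theorem chi_exists (n : ℕ) (t : Fin (n + 2) → ZMod 2) :
    ∃ c : (Fin (n + 2) → ZMod 2) → ℤ, (∀ a, c a = 1 ∨ c a = -1) ∧ (∀ a, c (t + a) = c a) ∧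
      ∑ a, c a = 0 := by
  have key : ∀ (l : (Fin (n + 2) → ZMod 2) → ZMod 2) (u : Fin (n + 2) → ZMod 2),
      (∀ a b, l (a + b) = l a + l b) → l t = 0 → l u = 1 →
      ∃ c : (Fin (n + 2) → ZMod 2) → ℤ, (∀ a, c a = 1 ∨ c a = -1) ∧ (∀ a, c (t + a) = c a) ∧
      ∑ a, c a = 0 := by
    intro l u hl ht hu
    refine ⟨fun a => if l a = 0 then 1 else -1, fun a => ?_, fun a => ?_, ?_⟩
    · dsimp only; split_ifs <;> simp
    · simp [hl, ht]
    · have := Equiv.sum_comp (Equiv.addLeft u) (fun a => if l a = 0 then (1 : ℤ) else -1)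
      have h2 : ∀ a, (if l (u + a) = 0 then (1 : ℤ) else -1) =
          - (if l a = 0 then (1 : ℤ) else -1) := by
        intro a
        rw [hl, hu]
        rcases zcases (l a) with h | h <;> simp [h, one_add_one_z]
      have h3 := (Finset.sum_congr rfl (fun a _ => h2 a)).symm.trans this
      rw [Finset.sum_neg_distrib] at h3
      dsimp only
      linarith
  rcases zcases (t 0) with h0 | h0
  · exact key (fun a => a 0) (Pi.single 0 1) (by simp) h0 (by simp)
  rcases zcases (t 1) with h1 | h1
  · exact key (fun a => a 1) (Pi.single 1 1) (by simp) h1 (by simp)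
  · refine key (fun a => a 0 + a 1) (Pi.single 0 1) (fun a b => ?_) ?_ (by simp)
    · simp only [Pi.add_apply]; ring
    · simp [h0, h1, one_add_one_z]

theorem weightP_prod (n : ℕ) : WeightP (ZMod 2 × (Fin (n + 2) → ZMod 2)) := by
  choose c c1 c2 c3 using chi_exists n
  have cabs : ∀ t a, |c t a| = 1 := fun t a => by rcases c1 t a with h | h <;> simp [h]
  have cne : ∀ t a, c t a ≠ 0 := fun t a => by rcases c1 t a with h | h <;> simp [h]
  obtain ⟨s, hs⟩ : ∃ s : Fin (n + 2) → ZMod 2, s ≠ 0 := exists_ne 0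
  refine ⟨fun p q => if p.2 = 0 then (if p.1 = 0 then 0 else 2 * c s q.2) else
    if p.2 = s then - c s q.2 else if p.1 = 0 then c p.2 q.2 else - c p.2 q.2, ?_, ?_, ?_, ?_, ?_⟩
  · rintro ⟨i, x⟩ ⟨j, a⟩
    by_cases hx : x = 0
    · simp [hx]
    by_cases hx' : x = s
    · subst hx'; simp [c2]
    · simp [hx, hx', c2]
  · rintro ⟨i, x⟩ ⟨j, a⟩
    by_cases hx : x = 0
    · simp [hx, cne]
    by_cases hx' : x = s
    · simp [hx', hs, cne]
    · rcases zcases i with rfl | rfl <;> simp [hx, hx', cne]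
  · rintro ⟨i, x⟩ ⟨j, a⟩
    dsimp only
    split_ifs <;> simp [abs_mul, cabs]
  · rintro ⟨i, x⟩
    rw [Fintype.sum_prod_type, sumZ]
    dsimp only
    split_ifs <;> simp [← Finset.mul_sum, c3]
  · rintro ⟨j, a⟩
    rw [Fintype.sum_prod_type, sumZ, ← Finset.sum_add_distrib]
    have : ∀ x, ((if x = 0 then (if (0 : ZMod 2) = 0 then 0 else 2 * c s a) else
        if x = s then - c s a else if (0 : ZMod 2) = 0 then c x a else - c x a) +
        (if x = 0 then (if (1 : ZMod 2) = 0 then 0 else 2 * c s a) else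
        if x = s then - c s a else if (1 : ZMod 2) = 0 then c x a else - c x a)) =
        (if x = 0 then 2 * c s a else 0) + (if x = s then - (2 * c s a) else 0) := by
      intro x
      by_cases hx : x = 0
      · subst hx; simp [Ne.symm hs]
      by_cases hx' : x = s
      · subst hx'; simp [hx]; ring
      · simp [hx, hx']
    refine (Finset.sum_congr rfl (fun x _ => this x)).trans ?_
    rw [Finset.sum_add_distrib]
    simp

theorem vadd_self {r : ℕ} (x : Fin r → ZMod 2) : x + x = 0 := by
  funext i
  have : ∀ a : ZMod 2, a + a = 0 := by decide
  exact this _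

theorem vadd_eq_zero {r : ℕ} (x y : Fin r → ZMod 2) : x + y = 0 ↔ x = y := by
  constructor
  · intro h
    have := congrArg (· + y) h
    simpa [add_assoc, vadd_self] using this
  · rintro rfl; exact vadd_self x

theorem flowP_all (n : ℕ) : FlowP (Fin (n + 4) → ZMod 2) := by
  induction n with
  | zero => exact flowP_base
  | succ n ih =>
    exact flowP_equiv (consAdd (n + 4)) (flowP_step vadd_self ih
      (weightP_equiv (consAdd (n + 3)) (weightP_prod (n + 1))))

theorem mem_ham {r : ℕ} {x y : Fin r → ZMod 2} (hx : x ≠ 0) (hy : y ≠ 0) (hxy : x ≠ y) :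
    ({x, y, x + y} : Finset (Fin r → ZMod 2)) ∈ hammingSTS r := by
  have h1 : x ≠ x + y := by simpa using hy
  have h2 : y ≠ x + y := by simpa using hx
  simp only [hammingSTS, Finset.mem_filter, Finset.mem_univ, true_and]
  refine ⟨Finset.card_eq_three.2 ⟨x, y, x + y, hxy, h1, h2, rfl⟩, ?_, ?_⟩
  · intro z hz
    simp only [Finset.mem_insert, Finset.mem_singleton] at hz
    rcases hz with rfl | rfl | rfl
    · exact hx
    · exact hy
    · rwa [Ne, vadd_eq_zero]
  · rw [Finset.sum_insert (by simp [hxy, hy]), Finset.sum_insert (by simpa using hx),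
      Finset.sum_singleton, ← add_assoc, vadd_self]

theorem ham_ne {r : ℕ} {T : Finset (Fin r → ZMod 2)} (hT : T ∈ hammingSTS r)
    {x : Fin r → ZMod 2} (h : x ∈ T) : x ≠ 0 := by
  simp only [hammingSTS, Finset.mem_filter, Finset.mem_univ, true_and] at hT
  exact hT.2.1 x h

theorem ham_card {r : ℕ} {T : Finset (Fin r → ZMod 2)} (hT : T ∈ hammingSTS r) : T.card = 3 := by
  simp only [hammingSTS, Finset.mem_filter, Finset.mem_univ, true_and] at hT
  exact hT.1

theorem ham_eq {r : ℕ} {T : Finset (Fin r → ZMod 2)} (hT : T ∈ hammingSTS r)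
    {x y : Fin r → ZMod 2} (hx : x ∈ T) (hy : y ∈ T) (hxy : x ≠ y) : T = {x, y, x + y} := by
  have h0 := ham_card hT
  have hx0 := ham_ne hT hx
  have hy0 := ham_ne hT hy
  simp only [hammingSTS, Finset.mem_filter, Finset.mem_univ, true_and] at hT
  have hy' : y ∈ T.erase x := Finset.mem_erase.2 ⟨hxy.symm, hy⟩
  have hc : ((T.erase x).erase y).card = 1 := by
    rw [Finset.card_erase_of_mem hy', Finset.card_erase_of_mem hx, h0]
  obtain ⟨z, hz⟩ := Finset.card_eq_one.1 hc
  have hs := hT.2.2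
  rw [← Finset.add_sum_erase _ _ hx, ← Finset.add_sum_erase _ _ hy', hz, Finset.sum_singleton,
    ← add_assoc, vadd_eq_zero] at hs
  rw [← Finset.insert_erase hx, ← Finset.insert_erase hy', hz, hs]

theorem ham_sum {r : ℕ} {x : Fin r → ZMod 2} (hx : x ≠ 0) (g : (Fin r → ZMod 2) → ℤ)
    (v : Finset (Fin r → ZMod 2) → ℤ)
    (h : ∀ T ∈ hammingSTS r, x ∈ T → ∀ y ∈ T, y ≠ x → g y = v T) :
    2 * ∑ T ∈ (hammingSTS r).filter (fun T => x ∈ T), v T =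
      ∑ y ∈ (Finset.univ.erase 0).erase x, g y := by
  rw [← Finset.sum_fiberwise_of_maps_to (g := fun y => ({x, y, x + y} : Finset (Fin r → ZMod 2)))
    (t := (hammingSTS r).filter (fun T => x ∈ T)), Finset.mul_sum]
  · refine Finset.sum_congr rfl fun T hT => ?_
    obtain ⟨hT, hxT⟩ := Finset.mem_filter.1 hT
    have hfib : ((Finset.univ.erase (0 : Fin r → ZMod 2)).erase x).filter
        (fun y => ({x, y, x + y} : Finset (Fin r → ZMod 2)) = T) = T.erase x := by
      ext y
      simp only [Finset.mem_filter, Finset.mem_erase, Finset.mem_univ, and_true]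
      constructor
      · rintro ⟨⟨h1, h2⟩, rfl⟩
        exact ⟨h1, by simp⟩
      · rintro ⟨h1, h2⟩
        exact ⟨⟨h1, ham_ne hT h2⟩, (ham_eq hT hxT h2 (Ne.symm h1)).symm⟩
    rw [hfib, Finset.sum_congr rfl (g := fun _ => v T), Finset.sum_const,
      Finset.card_erase_of_mem hxT, ham_card hT]
    · simp
    · intro y hy
      obtain ⟨h1, h2⟩ := Finset.mem_erase.1 hy
      exact h T hT hxT y h2 h1
  · intro y hy
    simp only [Finset.mem_erase, Finset.mem_univ, and_true] at hy
    exact Finset.mem_filter.2 ⟨mem_ham hx hy.2 (Ne.symm hy.1), by simp⟩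


theorem hamming_sts_flow (r : ℕ) (hr : 4 ≤ r) :
    -- (1) `hammingSTS r` is a Steiner triple system on the nonzero vectors
    (∀ p : Finset (Fin r → ZMod 2), p.card = 2 → (∀ x ∈ p, x ≠ 0) →
      ∃! T, T ∈ hammingSTS r ∧ p ⊆ T) ∧
    -- (2) it admits a 3-flow
    (∃ v : Finset (Fin r → ZMod 2) → ℤ,
      (∀ T ∈ hammingSTS r, v T ≠ 0 ∧ |v T| ≤ 2) ∧
      (∀ x : Fin r → ZMod 2, x ≠ 0 →
        ∑ T ∈ (hammingSTS r).filter (fun T => x ∈ T), v T = 0)) ∧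
    -- (3) it admits no 2-flow
    ¬ (∃ v : Finset (Fin r → ZMod 2) → ℤ,
      (∀ T ∈ hammingSTS r, v T ≠ 0 ∧ |v T| ≤ 1) ∧
      (∀ x : Fin r → ZMod 2, x ≠ 0 →
        ∑ T ∈ (hammingSTS r).filter (fun T => x ∈ T), v T = 0)) := by
  refine ⟨?_, ?_, ?_⟩
  · intro p hp hp0
    obtain ⟨x, y, hxy, rfl⟩ := Finset.card_eq_two.1 hp
    refine ⟨{x, y, x + y}, ⟨mem_ham (hp0 x (by simp)) (hp0 y (by simp)) hxy, ?_⟩, ?_⟩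
    · intro z hz
      simp only [Finset.mem_insert, Finset.mem_singleton] at hz ⊢
      tauto
    · rintro T ⟨hT, hs⟩
      exact ham_eq hT (hs (by simp)) (hs (by simp)) hxy
  · obtain ⟨n, rfl⟩ : ∃ n, r = n + 4 := ⟨r - 4, by omega⟩
    obtain ⟨g, g1, g2, g3, g4, g5⟩ := flowP_all n
    have key : ∀ T ∈ hammingSTS (n + 4), ∀ x ∈ T, ∀ y ∈ T, x ≠ y → ∀ x' ∈ T, ∀ y' ∈ T, x' ≠ y' →
        g x' y' = g x y := by
      intro T hT x hx y hy hxy x' hx' y' hy' hxy'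
      have g2' : ∀ x y, g y (x + y) = g x y := fun x y => by rw [add_comm, g2, g1]
      rw [ham_eq hT hx hy hxy] at hx' hy'
      simp only [Finset.mem_insert, Finset.mem_singleton] at hx' hy'
      rcases hx' with rfl | rfl | rfl <;> rcases hy' with rfl | rfl | rfl
      · exact absurd rfl hxy'
      · rfl
      · exact g2 _ _
      · exact g1 _ _
      · exact absurd rfl hxy'
      · exact g2' _ _
      · rw [g1, g2]
      · rw [g1, g2']
      · exact absurd rfl hxy'
    have ex : ∀ T : Finset (Fin (n + 4) → ZMod 2), ∃ c : ℤ, T ∈ hammingSTS (n + 4) →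
        ∀ x ∈ T, ∀ y ∈ T, x ≠ y → g x y = c := by
      intro T
      by_cases hT : T ∈ hammingSTS (n + 4)
      · obtain ⟨x, y, z, hxy, -, -, h⟩ := Finset.card_eq_three.1 (ham_card hT)
        exact ⟨g x y, fun _ x' hx' y' hy' h' =>
          key T hT x (by simp [h]) y (by simp [h]) hxy x' hx' y' hy' h'⟩
      · exact ⟨0, fun h => absurd h hT⟩
    choose v hv using ex
    refine ⟨v, fun T hT => ?_, fun x hx => ?_⟩
    · obtain ⟨x, y, z, hxy, -, -, h⟩ := Finset.card_eq_three.1 (ham_card hT)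
      have hxT : x ∈ T := by simp [h]
      have hyT : y ∈ T := by simp [h]
      rw [← hv T hT x hxT y hyT hxy]
      refine ⟨?_, g4 _ _⟩
      rw [Ne, g3]
      have := ham_ne hT hxT
      have := ham_ne hT hyT
      tauto
    · have h := ham_sum hx (g x) v (fun T hT hxT y hy hyx => hv T hT x hxT y hy (Ne.symm hyx))
      rw [Finset.sum_erase _ ((g3 x x).2 (by simp)), Finset.sum_erase _ ((g3 x 0).2 (by simp)),
        g5] at h
      linarith
  · rintro ⟨v, hv, hs⟩
    obtain ⟨m, rfl⟩ : ∃ m, r = m + 2 := ⟨r - 2, by omega⟩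
    obtain ⟨x, hx⟩ : ∃ x : Fin (m + 2) → ZMod 2, x ≠ 0 := exists_ne 0
    have h1 := ham_sum hx (fun _ => 1) (fun _ => 1) (fun _ _ _ _ _ _ => rfl)
    have hc : ((Finset.univ.erase (0 : Fin (m + 2) → ZMod 2)).erase x).card = 2 ^ (m + 2) - 1 - 1 := by
      rw [Finset.card_erase_of_mem (by simp [hx]), Finset.card_erase_of_mem (by simp)]
      simp [ZMod.card]
    rw [Finset.sum_const (s := (Finset.univ.erase 0).erase x), hc] at h1
    have h2 := hs x hx
    have h3 : (2 : ℤ) ∣ ∑ T ∈ (hammingSTS (m + 2)).filter (fun T => x ∈ T), (v T + 1) := by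
      refine Finset.dvd_sum fun T hT => ?_
      obtain ⟨a, b⟩ := hv T (Finset.mem_filter.1 hT).1
      rw [abs_le] at b
      omega
    rw [Finset.sum_add_distrib, h2] at h3
    have h4 : 1 ≤ 2 ^ m := Nat.one_le_two_pow
    have h5 : 2 ^ (m + 2) = 4 * 2 ^ m := by ring
    rw [h5, nsmul_eq_mul, mul_one] at h1
    omega
end

section
/- Let S be a Steiner triple system of order n with n ≥ 49. Then there exists a function h : S → Fin n such that (1) for every block T ∈ S, h(T) ∈ T, and (2) for every point i ∈ Fin n, the number of blocks T ∈ S with h(T) = i is at least 4. -/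
theorem sts_deg (n : ℕ) (hn : 49 ≤ n)
    (S : Finset (Finset (Fin n))) (hS : IsSTS n S) (i : Fin n) :
    12 ≤ (S.filter (fun T => i ∈ T)).card := by
  have h1 : (Finset.univ.erase i) ⊆ (S.filter (fun T => i ∈ T)).biUnion (fun T => T.erase i) := by
    intro j hj
    have hji : j ≠ i := Finset.ne_of_mem_erase hj
    obtain ⟨T, ⟨hT, hp⟩, _⟩ := hS.2 {i, j} (Finset.card_pair hji.symm)
    rw [Finset.mem_biUnion]
    refine ⟨T, Finset.mem_filter.2 ⟨hT, hp (by simp)⟩, Finset.mem_erase.2 ⟨hji, hp (by simp)⟩⟩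
  have h2 := Finset.card_le_card h1
  have h3 := Finset.card_biUnion_le_card_mul (S.filter (fun T => i ∈ T)) (fun T => T.erase i) 2 (by
    intro T hT
    rw [Finset.mem_filter] at hT
    rw [Finset.card_erase_of_mem hT.2, hS.1 T hT.1])
  rw [Finset.card_erase_of_mem (Finset.mem_univ i), Finset.card_univ, Fintype.card_fin] at h2
  omega

theorem exists_four_covering (n : ℕ) (hn : 49 ≤ n)
    (S : Finset (Finset (Fin n))) (hS : IsSTS n S) :
    ∃ h : Finset (Fin n) → Fin n,
      (∀ T ∈ S, h T ∈ T) ∧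
      (∀ i : Fin n, 4 ≤ (S.filter (fun T => h T = i)).card) := by
  classical
  obtain ⟨f, hf, hft⟩ := (Finset.all_card_le_biUnion_card_iff_exists_injective
    (fun x : Fin n × Fin 4 => S.filter (fun T => x.1 ∈ T))).1 (by
    intro A
    set U := A.biUnion (fun x : Fin n × Fin 4 => S.filter (fun T => x.1 ∈ T)) with hU
    have := Finset.card_mul_le_card_mul (s := A) (t := U) (m := 12) (n := 12)
      (fun x T => x.1 ∈ T) (by
        intro x hx
        refine (sts_deg n hn S hS x.1).trans (Finset.card_le_card ?_)
        intro T hT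
        rw [Finset.mem_bipartiteAbove]
        exact ⟨Finset.mem_biUnion.2 ⟨x, hx, hT⟩, (Finset.mem_filter.1 hT).2⟩) (by
        intro T hT
        obtain ⟨x, hx, hT'⟩ := Finset.mem_biUnion.1 hT
        have hc := hS.1 T (Finset.mem_filter.1 hT').1
        have hsub : A.bipartiteBelow (fun x T => x.1 ∈ T) T ⊆
            T ×ˢ (Finset.univ : Finset (Fin 4)) := by
          intro y hy
          rw [Finset.mem_bipartiteBelow] at hy
          exact Finset.mem_product.2 ⟨hy.2, Finset.mem_univ _⟩
        have := Finset.card_le_card hsub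
        rw [Finset.card_product, hc] at this
        simpa using this)
    omega)
  have hne : ∀ T ∈ S, ∃ i, i ∈ T := fun T hT =>
    Finset.card_pos.1 (by rw [hS.1 T hT]; norm_num)
  have key : ∀ T : Finset (Fin n), ∃ i : Fin n, (T ∈ S → i ∈ T) ∧ ∀ x, f x = T → x.1 = i := by
    intro T
    by_cases hx : ∃ x, f x = T
    · obtain ⟨x, rfl⟩ := hx
      exact ⟨x.1, fun _ => (Finset.mem_filter.1 (hft x)).2, fun y hy => by rw [hf hy]⟩
    · by_cases hT : T ∈ S
      · obtain ⟨i, hi⟩ := hne T hT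
        exact ⟨i, fun _ => hi, fun x h => (hx ⟨x, h⟩).elim⟩
      · exact ⟨⟨0, by omega⟩, fun h => (hT h).elim, fun x h => (hx ⟨x, h⟩).elim⟩
  choose h h1 h2 using key
  refine ⟨h, h1, fun i => ?_⟩
  have hinj : Function.Injective (fun k : Fin 4 => f (i, k)) := by
    intro a b hab
    exact (Prod.mk.inj (hf hab)).2
  have hc := Finset.card_image_of_injective Finset.univ hinj
  rw [Finset.card_univ, Fintype.card_fin] at hc
  rw [← hc]
  apply Finset.card_le_card
  intro T hT
  obtain ⟨k, _, rfl⟩ := Finset.mem_image.1 hT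
  exact Finset.mem_filter.2 ⟨(Finset.mem_filter.1 (hft (i, k))).1, (h2 _ (i, k) rfl).symm⟩
end

section
/- Let S be a Steiner triple system of order n with n ≥ 49 and let τ : S → Bool be arbitrary. Let the point set of the Assmus–Mattson system be X = (Fin n) ⊕ (Fin n) ⊕ Unit, writing i for the first copy of i ∈ Fin n, ī for the second copy, and ∞ for the extra point. For a block T ∈ S and a subset E ⊆ T, let T_E be the 3-element subset of X obtained from T by replacing each element of E by its barred copy and keeping the elements of T \ E unbarred. Define the Assmus–Mattson system S̄ on X as the collection consisting of: for every T ∈ S with τ(T) = false, the four triples T_E with |E| even (|E| ∈ {0,2}); for every T ∈ S with τ(T) = true, the four triples T_E with |E| odd (|E| ∈ {1,3}); and the triples {i, ī, ∞} for every i ∈ Fin n. Then S̄ is a Steiner triple system on X (of order 2n+1 ≥ 99) and S̄ admits a 5-flow, i.e. there exists v : S̄ → ℤ with v(T) ≠ 0 and |v(T)| ≤ 4 for every T ∈ S̄, such that ∑_{T ∈ S̄, p ∈ T} v(T) = 0 for every point p ∈ X. -/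
/-- The point set of the Assmus–Mattson system: two copies of `Fin n`
(unbarred and barred points) together with one extra point `∞`. -/
abbrev AMPoint (n : ℕ) := Fin n ⊕ Fin n ⊕ Unit

/-- `T_E`: the triple obtained from `T` by replacing each element of `E ⊆ T` by its
barred copy and keeping the elements of `T \ E` unbarred. -/
def amBlock (n : ℕ) (T E : Finset (Fin n)) : Finset (AMPoint n) :=
  (T \ E).image (fun i => (Sum.inl i : AMPoint n)) ∪
    E.image (fun i => (Sum.inr (Sum.inl i) : AMPoint n))

/-- The Assmus–Mattson Steiner triple system `S̄` built from `S` and `τ`: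
for `τ(T) = false` the four triples `T_E` with `|E|` even, for `τ(T) = true` the four
triples `T_E` with `|E|` odd, together with the triples `{i, ī, ∞}`. -/
def amSTS (n : ℕ) (S : Finset (Finset (Fin n))) (τ : Finset (Fin n) → Bool) :
    Finset (Finset (AMPoint n)) :=
  (S.biUnion fun T =>
    (T.powerset.filter fun E =>
      if τ T then Odd E.card else Even E.card).image (amBlock n T)) ∪
  Finset.univ.image (fun i : Fin n =>
    ({Sum.inl i, Sum.inr (Sum.inl i), Sum.inr (Sum.inr ())} : Finset (AMPoint n)))


theorem am_vals {α : Type*} [DecidableEq α] (k : ℕ) : ∀ (F : Finset α), F.card = k + 2 → ∀ m : ℤ, |m| ≤ 4 →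
    ∃ c : α → ℤ, (∀ x, c x ≠ 0 ∧ |c x| ≤ 2) ∧ ∑ x ∈ F, c x = m := by
  induction k with
  | zero =>
    intro F hF m hm
    obtain ⟨x, y, hxy, rfl⟩ := Finset.card_eq_two.mp hF
    have key : ∃ u v : ℤ, u ≠ 0 ∧ |u| ≤ 2 ∧ v ≠ 0 ∧ |v| ≤ 2 ∧ u + v = m := by
      rw [abs_le] at hm
      obtain ⟨h1, h2⟩ := hm
      have : m = -4 ∨ m = -3 ∨ m = -2 ∨ m = -1 ∨ m = 0 ∨ m = 1 ∨ m = 2 ∨ m = 3 ∨ m = 4 := by omega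
      rcases this with h | h | h | h | h | h | h | h | h <;> subst h
      · exact ⟨-2, -2, by norm_num⟩
      · exact ⟨-2, -1, by norm_num⟩
      · exact ⟨-1, -1, by norm_num⟩
      · exact ⟨-2, 1, by norm_num⟩
      · exact ⟨-1, 1, by norm_num⟩
      · exact ⟨2, -1, by norm_num⟩
      · exact ⟨1, 1, by norm_num⟩
      · exact ⟨2, 1, by norm_num⟩
      · exact ⟨2, 2, by norm_num⟩
    obtain ⟨u, v, hu, hu2, hv, hv2, huv⟩ := key
    refine ⟨fun w => if w = x then u else v, ?_, ?_⟩
    · intro w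
      dsimp only
      split_ifs
      · exact ⟨hu, hu2⟩
      · exact ⟨hv, hv2⟩
    · rw [Finset.sum_pair hxy, if_pos rfl, if_neg (Ne.symm hxy), huv]
  | succ k ih =>
    intro F hF m hm
    have hne : F.Nonempty := by rw [← Finset.card_pos]; omega
    obtain ⟨x, hx⟩ := hne
    have key : ∃ u : ℤ, u ≠ 0 ∧ |u| ≤ 2 ∧ |m - u| ≤ 4 := by
      rw [abs_le] at hm
      rcases le_or_gt 0 m with h | h
      · exact ⟨1, by norm_num, by norm_num, by rw [abs_le]; omega⟩
      · exact ⟨-1, by norm_num, by norm_num, by rw [abs_le]; omega⟩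
    obtain ⟨u, hu, hu2, hmu⟩ := key
    obtain ⟨c, hc, hs⟩ := ih (F.erase x) (by rw [Finset.card_erase_of_mem hx]; omega) (m - u) hmu
    refine ⟨fun w => if w = x then u else c w, ?_, ?_⟩
    · intro w
      dsimp only
      split_ifs
      · exact ⟨hu, hu2⟩
      · exact hc w
    · rw [← Finset.add_sum_erase F _ hx, if_pos rfl]
      have : ∑ w ∈ F.erase x, (if w = x then u else c w) = ∑ w ∈ F.erase x, c w := by
        apply Finset.sum_congr rfl
        intro w hw
        rw [if_neg (Finset.ne_of_mem_erase hw)]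
      rw [this, hs]; ring

theorem am_uniq {n : ℕ} {S : Finset (Finset (Fin n))} (hS : IsSTS n S) {a b : Fin n} (hab : a ≠ b)
    {T U : Finset (Fin n)} (hT : T ∈ S) (hU : U ∈ S) (haT : a ∈ T) (hbT : b ∈ T) (haU : a ∈ U)
    (hbU : b ∈ U) : T = U := by
  have h := hS.2 {a, b} (Finset.card_pair hab)
  exact h.unique ⟨hT, by simp [Finset.insert_subset_iff, haT, hbT]⟩
    ⟨hU, by simp [Finset.insert_subset_iff, haU, hbU]⟩

theorem am_ex {n : ℕ} {S : Finset (Finset (Fin n))} (hS : IsSTS n S) {a b : Fin n} (hab : a ≠ b) :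
    ∃ T ∈ S, a ∈ T ∧ b ∈ T := by
  obtain ⟨T, ⟨h1, h2⟩, -⟩ := hS.2 {a, b} (Finset.card_pair hab)
  exact ⟨T, h1, h2 (by simp), h2 (by simp)⟩

theorem am_deg {n : ℕ} {S : Finset (Finset (Fin n))} (hS : IsSTS n S) (p : Fin n) :
    (S.filter (p ∈ ·)).card * 2 = n - 1 := by
  have h1 : (Finset.univ.erase p : Finset (Fin n)) =
      (S.filter (p ∈ ·)).biUnion (fun T => T.erase p) := by
    ext q
    simp only [Finset.mem_erase, Finset.mem_univ, and_true, Finset.mem_biUnion, Finset.mem_filter]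
    constructor
    · intro hq
      obtain ⟨T, hT, h1, h2⟩ := am_ex hS hq
      exact ⟨T, ⟨hT, h2⟩, hq, h1⟩
    · rintro ⟨T, _, h, _⟩
      exact h
  have h2 := congrArg Finset.card h1
  rw [Finset.card_biUnion, Finset.card_erase_of_mem (Finset.mem_univ p), Finset.card_univ,
    Fintype.card_fin, Finset.sum_congr rfl (g := fun _ => 2)] at h2
  · rw [h2]; simp
  · intro T hT
    rw [Finset.mem_filter] at hT
    rw [Finset.card_erase_of_mem hT.2, hS.1 T hT.1]
  · intro T hT U hU hTU
    rw [Finset.mem_coe, Finset.mem_filter] at hT hU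
    change Disjoint (T.erase p) (U.erase p)
    rw [Finset.disjoint_left]
    intro q hq hq'
    rw [Finset.mem_erase] at hq hq'
    exact hTU (am_uniq hS hq.1 hT.1 hU.1 hq.2 hT.2 hq'.2 hU.2)

/-- the star part -/
theorem am_star {n : ℕ} (hn : 49 ≤ n) {S : Finset (Finset (Fin n))} (hS : IsSTS n S) (z : Fin n) :
    ∃ T0 ∈ S, z ∉ T0 ∧ ∃ s : Finset (Fin n) → ℤ, (∀ T, s T ≠ 0 ∧ |s T| ≤ 2) ∧
      (∑ T ∈ S.filter (fun T => z ∈ T ∨ T = T0), s T = 0) ∧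
      ∀ i, (∑ T ∈ (S.filter (fun T => z ∈ T ∨ T = T0)).filter (i ∈ ·), s T ≠ 0 ∧
        |∑ T ∈ (S.filter (fun T => z ∈ T ∨ T = T0)).filter (i ∈ ·), s T| ≤ 2) := by
  have hT0 : ∃ T0 ∈ S, z ∉ T0 := by
    obtain ⟨a, ha⟩ : ∃ a : Fin n, a ∉ ({z} : Finset (Fin n)) := by
      by_contra! h
      have := Finset.card_le_card (fun x _ => h x : (Finset.univ : Finset (Fin n)) ⊆ {z})
      simp at this; omega
    have ha : a ≠ z := by simpa using ha
    obtain ⟨A, hA, haA, hzA⟩ := am_ex hS ha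
    obtain ⟨b, hb⟩ : ∃ b : Fin n, b ∉ A := by
      by_contra! h
      have := Finset.card_le_card (fun x _ => h x : (Finset.univ : Finset (Fin n)) ⊆ A)
      rw [hS.1 A hA] at this
      simp at this; omega
    have hab : a ≠ b := by rintro rfl; exact hb haA
    obtain ⟨T, hT, h1, h2⟩ := am_ex hS hab
    refine ⟨T, hT, fun hz => hb ?_⟩
    rw [am_uniq hS ha hA hT haA hzA h1 hz]
    exact h2
  obtain ⟨T0, hT0, hz⟩ := hT0
  refine ⟨T0, hT0, hz, ?_⟩
  have hblk : ∀ i : Fin n, ∃ T, i ≠ z → T ∈ S ∧ i ∈ T ∧ z ∈ T := by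
    intro i
    by_cases h : i = z
    · exact ⟨∅, fun h' => absurd h h'⟩
    · obtain ⟨T, h1, h2, h3⟩ := am_ex hS h
      exact ⟨T, fun _ => ⟨h1, h2, h3⟩⟩
  choose B hB using hblk
  set star := S.filter (z ∈ ·) with hstar
  set K := star.filter (fun T => ¬ Disjoint T T0) with hK
  set F := star.filter (fun T => Disjoint T T0) with hF
  have hKc : K.card ≤ 3 := by
    rw [← hS.1 T0 hT0]
    refine (Finset.card_le_card (t := T0.image B) ?_).trans Finset.card_image_le
    intro T hT
    simp only [hK, hstar, Finset.mem_filter, Finset.not_disjoint_iff] at hT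
    obtain ⟨⟨h1, h2⟩, i, h3, h4⟩ := hT
    have hiz : i ≠ z := by rintro rfl; exact hz h4
    obtain ⟨h5, h6, h7⟩ := hB i hiz
    exact Finset.mem_image.mpr ⟨i, h4, am_uniq hS hiz h5 h1 h6 h7 h3 h2⟩
  have hFK : F.card + K.card = star.card := Finset.card_filter_add_card_filter_not _
  have hdeg := am_deg hS z
  rw [← hstar] at hdeg
  obtain ⟨c, hc, hcs⟩ := am_vals (F.card - 2) F (by omega) (-1 - K.card)
    (by rw [abs_le]; constructor <;> omega)
  refine ⟨fun T => if Disjoint T T0 then c T else 1, ?_, ?_⟩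
  · intro T
    dsimp only
    split_ifs
    · exact hc T
    · norm_num
  have hR : S.filter (fun T => z ∈ T ∨ T = T0) = insert T0 star := by
    ext T
    simp only [hstar, Finset.mem_filter, Finset.mem_insert]
    constructor
    · rintro ⟨h, h' | h'⟩ <;> tauto
    · rintro (rfl | h)
      · exact ⟨hT0, Or.inr rfl⟩
      · tauto
  have hT0s : T0 ∉ star := by simp [hstar, hz]
  have hnd : ¬ Disjoint T0 T0 := by
    rw [disjoint_self]
    intro h
    have := hS.1 T0 hT0
    rw [h] at this
    simp at this
  have hsum : ∑ T ∈ star, (if Disjoint T T0 then c T else 1) = -1 := by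
    rw [Finset.sum_ite, ← hF, ← hK, hcs]; simp
  rw [hR]
  refine ⟨?_, ?_⟩
  · rw [Finset.sum_insert hT0s, hsum, if_neg hnd]; norm_num
  intro i
  by_cases hi : i = z
  · subst hi
    have : (insert T0 star).filter (i ∈ ·) = star := by
      ext T
      simp only [hstar, Finset.mem_filter, Finset.mem_insert]
      constructor
      · rintro ⟨rfl | h, h'⟩
        · exact absurd h' hz
        · exact h
      · intro h
        exact ⟨Or.inr h, h.2⟩
    rw [this, hsum]; norm_num
  · obtain ⟨h5, h6, h7⟩ := hB i hi
    have hst : star.filter (i ∈ ·) = {B i} := by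
      ext T
      simp only [hstar, Finset.mem_filter, Finset.mem_singleton]
      constructor
      · rintro ⟨⟨h1, h2⟩, h3⟩
        exact am_uniq hS hi h1 h5 h3 h2 h6 h7
      · rintro rfl
        exact ⟨⟨h5, h7⟩, h6⟩
    rw [Finset.filter_insert, hst]
    by_cases hiT : i ∈ T0
    · rw [if_pos hiT]
      have hne : T0 ∉ ({B i} : Finset (Finset (Fin n))) := by
        rw [Finset.mem_singleton]
        intro h
        rw [h] at hz
        exact hz h7
      rw [Finset.sum_insert hne, Finset.sum_singleton, if_neg hnd, if_neg]
      · norm_num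
      · rw [Finset.not_disjoint_iff]
        exact ⟨i, h6, hiT⟩
    · rw [if_neg hiT, Finset.sum_singleton]
      split_ifs
      · exact hc _
      · norm_num

theorem am_asg {n : ℕ} (hn : 49 ≤ n) {S : Finset (Finset (Fin n))} (hS : IsSTS n S) (z : Fin n)
    (T0 : Finset (Fin n)) :
    ∃ (asg : Finset (Fin n) → Fin n) (c : Finset (Fin n) → ℤ),
      (∀ T ∈ S, asg T ∈ T) ∧ (∀ T, c T ≠ 0 ∧ |c T| ≤ 2) ∧
      ∀ i, ∑ T ∈ (S.filter (fun T => ¬ (z ∈ T ∨ T = T0))).filter (fun T => asg T = i), c T = 0 := by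
  set D := S.filter (fun T => ¬ (z ∈ T ∨ T = T0)) with hD
  have hDeg : ∀ p, p ≠ z → 22 ≤ (D.filter (p ∈ ·)).card := by
    intro p hp
    obtain ⟨U, hU, hpU, hzU⟩ := am_ex hS hp
    have hsub : S.filter (p ∈ ·) ⊆ insert U (insert T0 (D.filter (p ∈ ·))) := by
      intro T hT
      simp only [hD, Finset.mem_filter, Finset.mem_insert] at hT ⊢
      by_cases h1 : z ∈ T
      · left
        exact am_uniq hS hp hT.1 hU hT.2 h1 hpU hzU
      · tauto
    have h1 := Finset.card_le_card hsub
    have h2 := Finset.card_insert_le U (insert T0 (D.filter (p ∈ ·)))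
    have h3 := Finset.card_insert_le T0 (D.filter (p ∈ ·))
    have h4 := am_deg hS p
    omega
  have hall : ∃ f : {p : Fin n // p ≠ z} × Fin 2 → Finset (Fin n), Function.Injective f ∧
      ∀ x, f x ∈ D.filter (fun T => x.1.1 ∈ T) := by
    rw [← Finset.all_card_le_biUnion_card_iff_exists_injective
      (fun x : {p : Fin n // p ≠ z} × Fin 2 => D.filter (fun T => x.1.1 ∈ T))]
    intro A
    set P : Finset (Fin n) := A.image (fun x => x.1.1) with hP
    set N := A.biUnion (fun x => D.filter (fun T => x.1.1 ∈ T)) with hN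
    have hAP : A.card ≤ P.card * 2 := by
      have : A.card ≤ (P ×ˢ (Finset.univ : Finset (Fin 2))).card := by
        apply Finset.card_le_card_of_injOn (fun x => (x.1.1, x.2))
        · intro x hx
          simp only [Finset.coe_product, Set.mem_prod, Finset.mem_coe, Finset.mem_univ, and_true]
          exact Finset.mem_image_of_mem _ hx
        · rintro ⟨⟨a, ha⟩, b⟩ _ ⟨⟨a', ha'⟩, b'⟩ _ h
          simpa using h
      simpa [Finset.card_product] using this
    have hdc := Finset.sum_card_bipartiteAbove_eq_sum_card_bipartiteBelow
      (s := P) (t := N) (fun p T => p ∈ T)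
    have h1 : P.card * 22 ≤ ∑ p ∈ P, (N.bipartiteAbove (fun p T => p ∈ T) p).card := by
      rw [← smul_eq_mul]
      apply Finset.card_nsmul_le_sum
      intro p hp
      obtain ⟨x, hx, rfl⟩ := Finset.mem_image.mp hp
      refine (hDeg x.1.1 x.1.2).trans (Finset.card_le_card ?_)
      intro T hT
      rw [Finset.mem_bipartiteAbove]
      exact ⟨Finset.mem_biUnion.mpr ⟨x, hx, hT⟩, (Finset.mem_filter.mp hT).2⟩
    have h2 : ∑ T ∈ N, (P.bipartiteBelow (fun p T => p ∈ T) T).card ≤ N.card * 3 := by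
      rw [← smul_eq_mul]
      apply Finset.sum_le_card_nsmul
      intro T hT
      obtain ⟨x, hx, hT⟩ := Finset.mem_biUnion.mp hT
      have hTS : T ∈ S := (Finset.mem_filter.mp (Finset.mem_filter.mp hT).1).1
      rw [← hS.1 T hTS]
      apply Finset.card_le_card
      intro p hp
      rw [Finset.mem_bipartiteBelow] at hp
      exact hp.2
    omega
  obtain ⟨f, hf, hfm⟩ := hall
  have hasg : ∀ T : Finset (Fin n), ∃ p : Fin n, (T ∈ S → p ∈ T) ∧ ∀ x, f x = T → p = x.1.1 := by
    intro T
    by_cases h : ∃ x, f x = T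
    · obtain ⟨x, rfl⟩ := h
      refine ⟨x.1.1, fun _ => (Finset.mem_filter.mp (hfm x)).2, fun y hy => ?_⟩
      rw [hf hy]
    · by_cases hT : T ∈ S
      · have : T.Nonempty := by rw [← Finset.card_pos, hS.1 T hT]; norm_num
        obtain ⟨p, hp⟩ := this
        exact ⟨p, fun _ => hp, fun x hx => absurd ⟨x, hx⟩ h⟩
      · exact ⟨z, fun h => absurd h hT, fun x hx => absurd ⟨x, hx⟩ h⟩
  choose asg ha1 ha2 using hasg
  have hc : ∀ i : Fin n, ∃ c : Finset (Fin n) → ℤ, (∀ T, c T ≠ 0 ∧ |c T| ≤ 2) ∧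
      ∑ T ∈ D.filter (fun T => asg T = i), c T = 0 := by
    intro i
    by_cases hi : i = z
    · refine ⟨fun _ => 1, by norm_num, ?_⟩
      rw [Finset.filter_eq_empty_iff.mpr, Finset.sum_empty]
      intro T hT h
      have h1 := Finset.mem_filter.mp hT
      have h2 := ha1 T h1.1
      rw [h, hi] at h2
      exact h1.2 (Or.inl h2)
    · have hmem : ∀ b, f (⟨i, hi⟩, b) ∈ D.filter (fun T => asg T = i) := by
        intro b
        rw [Finset.mem_filter]
        exact ⟨(Finset.mem_filter.mp (hfm _)).1, ha2 _ _ rfl⟩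
      have hcard : 1 < (D.filter (fun T => asg T = i)).card := by
        rw [Finset.one_lt_card]
        refine ⟨_, hmem 0, _, hmem 1, fun h => ?_⟩
        have := hf h
        simp at this
      exact am_vals _ _ (by rw [Nat.sub_add_cancel]; exact hcard) 0 (by norm_num)
  choose c hc1 hc2 using hc
  refine ⟨asg, fun T => c (asg T) T, fun T hT => ha1 T hT, fun T => hc1 _ _, fun i => ?_⟩
  rw [← hc2 i]
  apply Finset.sum_congr rfl
  intro T hT
  change c (asg T) T = c i T
  rw [(Finset.mem_filter.mp hT).2]

theorem am_mem1 {n : ℕ} (T E : Finset (Fin n)) (i : Fin n) :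
    (Sum.inl i : AMPoint n) ∈ amBlock n T E ↔ i ∈ T ∧ i ∉ E := by
  simp [amBlock]

theorem am_mem2 {n : ℕ} (T E : Finset (Fin n)) (i : Fin n) :
    (Sum.inr (Sum.inl i) : AMPoint n) ∈ amBlock n T E ↔ i ∈ E := by
  simp [amBlock]

theorem am_mem3 {n : ℕ} (T E : Finset (Fin n)) (u : Unit) :
    (Sum.inr (Sum.inr u) : AMPoint n) ∉ amBlock n T E := by
  simp [amBlock]

theorem am_inj {n : ℕ} {T E T' E' : Finset (Fin n)} (h : E ⊆ T) (h' : E' ⊆ T')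
    (he : amBlock n T E = amBlock n T' E') : T = T' ∧ E = E' := by
  have hE : E = E' := by
    ext i
    rw [← am_mem2 T E, he, am_mem2]
  refine ⟨?_, hE⟩
  subst hE
  ext i
  have := am_mem1 T E i
  rw [he, am_mem1] at this
  by_cases hi : i ∈ E
  · exact ⟨fun _ => h' hi, fun _ => h hi⟩
  · tauto

def amInf (n : ℕ) (i : Fin n) : Finset (AMPoint n) :=
  {Sum.inl i, Sum.inr (Sum.inl i), Sum.inr (Sum.inr ())}

theorem am_inf1 {n : ℕ} (i j : Fin n) : (Sum.inl j : AMPoint n) ∈ amInf n i ↔ j = i := by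
  simp [amInf]
theorem am_inf2 {n : ℕ} (i j : Fin n) :
    (Sum.inr (Sum.inl j) : AMPoint n) ∈ amInf n i ↔ j = i := by
  simp [amInf]
theorem am_inf3 {n : ℕ} (i : Fin n) (u : Unit) :
    (Sum.inr (Sum.inr u) : AMPoint n) ∈ amInf n i := by
  simp [amInf]

theorem am_mem {n : ℕ} {S : Finset (Finset (Fin n))} {τ : Finset (Fin n) → Bool}
    {B : Finset (AMPoint n)} : B ∈ amSTS n S τ ↔
      (∃ T ∈ S, ∃ E ⊆ T, (if τ T then Odd E.card else Even E.card) ∧ amBlock n T E = B) ∨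
      ∃ i, amInf n i = B := by
  simp only [amSTS, Finset.mem_union, Finset.mem_biUnion, Finset.mem_image, Finset.mem_filter,
    Finset.mem_powerset, Finset.mem_univ, true_and, and_assoc, amInf]

theorem am_sum {n : ℕ} (S : Finset (Finset (Fin n))) (τ : Finset (Fin n) → Bool)
    (F : Finset (AMPoint n) → ℤ) : ∑ B ∈ amSTS n S τ, F B =
      ∑ T ∈ S, (∑ E ∈ T.powerset, if (if τ T then Odd E.card else Even E.card) then
        F (amBlock n T E) else 0) + ∑ i, F (amInf n i) := by
  rw [amSTS, Finset.sum_union, Finset.sum_biUnion]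
  · congr 1
    · apply Finset.sum_congr rfl
      intro T _
      rw [Finset.sum_image, Finset.sum_filter]
      intro E hE E' hE' h
      simp only [Finset.coe_filter, Set.mem_setOf_eq, Finset.mem_powerset] at hE hE'
      exact (am_inj hE.1 hE'.1 h).2
    · rw [Finset.sum_image]
      · rfl
      · intro i _ j _ h
        have := am_inf1 j i
        rw [← this, show amInf n j = amInf n i from h.symm, am_inf1]
  · intro T _ T' _ hTT
    change Disjoint (Finset.image _ _) (Finset.image _ _)
    rw [Finset.disjoint_left]
    intro B hB hB'
    simp only [Finset.mem_image, Finset.mem_filter, Finset.mem_powerset] at hB hB'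
    obtain ⟨E, hE, rfl⟩ := hB
    obtain ⟨E', hE', h⟩ := hB'
    exact hTT (am_inj hE'.1 hE.1 h).1.symm
  · rw [Finset.disjoint_left]
    intro B hB hB'
    simp only [Finset.mem_biUnion, Finset.mem_image, Finset.mem_filter] at hB hB'
    obtain ⟨T, _, E, _, rfl⟩ := hB
    obtain ⟨i, _, h⟩ := hB'
    apply am_mem3 T E ()
    rw [← h]
    exact am_inf3 i ()

theorem am_four {n : ℕ} {a b c : Fin n} (hab : a ≠ b) (hac : a ≠ c) (hbc : b ≠ c) (t : Bool)
    (G : Finset (Fin n) → ℤ) :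
    (∑ E ∈ ({a, b, c} : Finset (Fin n)).powerset,
      if (if t then Odd E.card else Even E.card) then G E else 0) =
    if t then G {a} + G {b} + G {c} + G {a, b, c} else G ∅ + G {a, b} + G {a, c} + G {b, c} := by
  have h1 : a ∉ ({b, c} : Finset (Fin n)) := by simp [hab, hac]
  have h2 : b ∉ ({c} : Finset (Fin n)) := by simp [hbc]
  have h3 : c ∉ (∅ : Finset (Fin n)) := by simp
  have e : ({a, b, c} : Finset (Fin n)) = insert a (insert b (insert c ∅)) := by simp
  have h1' : a ∉ (insert b (insert c ∅) : Finset (Fin n)) := by simp [hab, hac]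
  have h2' : b ∉ (insert c ∅ : Finset (Fin n)) := by simp [hbc]
  have c3 : ({a, b, c} : Finset (Fin n)).card = 3 := by
    rw [Finset.card_insert_of_notMem h1, Finset.card_pair hbc]
  rw [e, Finset.sum_powerset_insert h1']
  simp only [Finset.sum_powerset_insert h2', Finset.sum_powerset_insert h3]
  simp only [Finset.powerset_empty, Finset.sum_singleton, insert_empty_eq, Finset.card_empty,
    Finset.card_singleton, Finset.card_pair hab, Finset.card_pair hac, Finset.card_pair hbc, c3]
  have o3 : Odd 3 := by decide
  have e3 : ¬ Even 3 := by decide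
  have o2 : ¬ Odd 2 := by decide
  cases t <;> simp [o3, e3, o2] <;> ring

/-- contribution of a block with all equal values -/
theorem am_contrR {n : ℕ} {T : Finset (Fin n)} (hT : T.card = 3) (t : Bool) (s : ℤ)
    {i : Fin n} (hi : i ∈ T) :
    (∑ E ∈ T.powerset, (if (if t then Odd E.card else Even E.card) then
      (if i ∈ T ∧ i ∉ E then s else 0) else 0)) = 2 * s ∧
    (∑ E ∈ T.powerset, (if (if t then Odd E.card else Even E.card) then
      (if i ∈ E then s else 0) else 0)) = 2 * s := by
  have h2 : (T.erase i).card = 2 := by rw [Finset.card_erase_of_mem hi, hT]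
  obtain ⟨b, c, hbc, h⟩ := Finset.card_eq_two.mp h2
  have hT' : T = {i, b, c} := by rw [← Finset.insert_erase hi, h]
  have hib : i ≠ b := by rintro rfl; have : i ∈ T.erase i := by simp [h]
                         simp at this
  have hic : i ≠ c := by rintro rfl; have : i ∈ T.erase i := by simp [h]
                         simp at this
  subst hT'
  rw [am_four hib hic hbc, am_four hib hic hbc]
  cases t <;> simp [hib, hic, hbc, hib.symm, hic.symm, hbc.symm] <;> ring

/-- contribution of a block with distinguished point -/
theorem am_contrD {n : ℕ} {T : Finset (Fin n)} (hT : T.card = 3) (t : Bool) (s : ℤ)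
    {a i : Fin n} (ha : a ∈ T) (hi : i ∈ T) :
    (∑ E ∈ T.powerset, (if (if t then Odd E.card else Even E.card) then
      (if i ∈ T ∧ i ∉ E then (if a ∈ E then -s else s) else 0) else 0)) =
        (if a = i then 2 * s else 0) ∧
    (∑ E ∈ T.powerset, (if (if t then Odd E.card else Even E.card) then
      (if i ∈ E then (if a ∈ E then -s else s) else 0) else 0)) =
        -(if a = i then 2 * s else 0) := by
  have h2 : (T.erase i).card = 2 := by rw [Finset.card_erase_of_mem hi, hT]
  obtain ⟨b, c, hbc, h⟩ := Finset.card_eq_two.mp h2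
  have hT' : T = {i, b, c} := by rw [← Finset.insert_erase hi, h]
  have hib : i ≠ b := by rintro rfl; have : i ∈ T.erase i := by simp [h]
                         simp at this
  have hic : i ≠ c := by rintro rfl; have : i ∈ T.erase i := by simp [h]
                         simp at this
  subst hT'
  rw [am_four hib hic hbc, am_four hib hic hbc]
  have ha' : a = i ∨ a = b ∨ a = c := by simpa using ha
  rcases ha' with rfl | rfl | rfl <;>
  cases t <;> simp [hib, hic, hbc, hib.symm, hic.symm, hbc.symm] <;> (try constructor) <;> ring

theorem am_flow {n : ℕ} (hn : 49 ≤ n)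
    {S : Finset (Finset (Fin n))} (hS : IsSTS n S) (τ : Finset (Fin n) → Bool) :
    ∃ v : Finset (AMPoint n) → ℤ,
      (∀ T ∈ amSTS n S τ, v T ≠ 0 ∧ |v T| ≤ 4) ∧
      (∀ p : AMPoint n, ∑ T ∈ (amSTS n S τ).filter (fun T => p ∈ T), v T = 0) := by
  obtain ⟨T0, hT0, hz, s, hs, hs0, hsi⟩ := am_star hn hS ⟨0, by omega⟩
  obtain ⟨asg, c, ha, hc, hci⟩ := am_asg hn hS ⟨0, by omega⟩ T0
  set R : Finset (Fin n) → Prop := fun T => (⟨0, by omega⟩ : Fin n) ∈ T ∨ T = T0 with hR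
  set g : Finset (Fin n) → Finset (Fin n) → ℤ := fun T E =>
    if R T then s T else if asg T ∈ E then - c T else c T with hg
  set σ : Fin n → ℤ := fun i => ∑ T ∈ (S.filter (fun T => R T)).filter (i ∈ ·), s T with hσ
  set v : Finset (AMPoint n) → ℤ := fun B =>
    if (Sum.inr (Sum.inr ()) : AMPoint n) ∈ B then
      ∑ i ∈ Finset.univ.filter (fun i : Fin n => (Sum.inl i : AMPoint n) ∈ B), (-2 * σ i)
    else g (Finset.univ.filter (fun i : Fin n => (Sum.inl i : AMPoint n) ∈ B ∨
        (Sum.inr (Sum.inl i) : AMPoint n) ∈ B))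
      (Finset.univ.filter (fun i : Fin n => (Sum.inr (Sum.inl i) : AMPoint n) ∈ B)) with hv
  have hv1 : ∀ T E, E ⊆ T → v (amBlock n T E) = g T E := by
    intro T E hE
    have e1 : Finset.univ.filter (fun i : Fin n => i ∈ T ∧ i ∉ E ∨ i ∈ E) = T := by
      ext i
      simp only [Finset.mem_filter, Finset.mem_univ, true_and]
      have := @hE i
      tauto
    have e2 : Finset.univ.filter (fun i : Fin n => i ∈ E) = E := by ext; simp
    simp only [hv, am_mem1, am_mem2, am_mem3, if_false, e1, e2]
  have hv2 : ∀ i, v (amInf n i) = -2 * σ i := by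
    intro i
    simp only [hv, am_inf1, am_inf3, if_true, Finset.filter_eq', Finset.mem_univ,
      Finset.sum_singleton]
  refine ⟨v, ?_, ?_⟩
  · intro B hB
    rcases am_mem.mp hB with ⟨T, hT, E, hE, -, rfl⟩ | ⟨i, rfl⟩
    · rw [hv1 T E hE]
      simp only [hg]
      have h1 := hs T
      have h2 := hc T
      rw [abs_le] at h1 h2
      split_ifs <;> rw [abs_le] <;> omega
    · rw [hv2]
      have := hsi i
      change σ i ≠ 0 ∧ |σ i| ≤ 2 at this
      rw [abs_le] at this ⊢
      omega
  have hgsum : ∀ (p : AMPoint n) (T : Finset (Fin n)), (∑ E ∈ T.powerset,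
      if (if τ T then Odd E.card else Even E.card) then
        (if p ∈ amBlock n T E then v (amBlock n T E) else 0) else 0) =
      ∑ E ∈ T.powerset, if (if τ T then Odd E.card else Even E.card) then
        (if p ∈ amBlock n T E then g T E else 0) else 0 := by
    intro p T
    apply Finset.sum_congr rfl
    intro E hE
    rw [hv1 T E (Finset.mem_powerset.mp hE)]
  have hsplit : ∀ (i : Fin n) (e : ℤ), ∑ T ∈ S, (if R T then (if i ∈ T then 2 * s T else 0) else
      (if asg T = i then e * (2 * c T) else 0)) = 2 * σ i := by
    intro i e
    rw [Finset.sum_ite]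
    have h1 : ∑ T ∈ S.filter (fun T => R T), (if i ∈ T then 2 * s T else 0) = 2 * σ i := by
      rw [← Finset.sum_filter, ← Finset.mul_sum]
    have h2 : ∑ T ∈ S.filter (fun T => ¬ R T), (if asg T = i then e * (2 * c T) else 0) = 0 := by
      rw [← Finset.sum_filter, ← Finset.mul_sum, ← Finset.mul_sum]
      rw [hci i]; ring
    rw [h1, h2, add_zero]
  intro p
  rw [Finset.sum_filter, am_sum]
  simp only [hgsum]
  rcases p with i | i | u
  · have hinf : (∑ j, if (Sum.inl i : AMPoint n) ∈ amInf n j then v (amInf n j) else 0) =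
        -2 * σ i := by
      simp only [am_inf1, hv2, Finset.sum_ite_eq, Finset.mem_univ, if_true]
    rw [hinf, Finset.sum_congr rfl (g := fun T => (if R T then (if i ∈ T then 2 * s T else 0) else
      (if asg T = i then 1 * (2 * c T) else 0))), hsplit]
    · ring
    intro T hT
    simp only [am_mem1, hg]
    by_cases hi : i ∈ T
    · by_cases hRT : R T
      · simp only [hRT, if_true]
        rw [(am_contrR (hS.1 T hT) (τ T) (s T) hi).1, if_pos hi]
      · simp only [hRT, if_false]
        rw [(am_contrD (hS.1 T hT) (τ T) (c T) (ha T hT) hi).1, one_mul]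
    · have hai : asg T ≠ i := by rintro rfl; exact hi (ha T hT)
      simp [hi, hai]
  · have hinf : (∑ j, if (Sum.inr (Sum.inl i) : AMPoint n) ∈ amInf n j then v (amInf n j) else 0) =
        -2 * σ i := by
      simp only [am_inf2, hv2, Finset.sum_ite_eq, Finset.mem_univ, if_true]
    rw [hinf, Finset.sum_congr rfl (g := fun T => (if R T then (if i ∈ T then 2 * s T else 0) else
      (if asg T = i then (-1) * (2 * c T) else 0))), hsplit]
    · ring
    intro T hT
    simp only [am_mem2, hg]
    by_cases hi : i ∈ T
    · by_cases hRT : R T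
      · simp only [hRT, if_true]
        rw [(am_contrR (hS.1 T hT) (τ T) (s T) hi).2, if_pos hi]
      · simp only [hRT, if_false]
        rw [(am_contrD (hS.1 T hT) (τ T) (c T) (ha T hT) hi).2]
        split_ifs <;> ring
    · have hai : asg T ≠ i := by rintro rfl; exact hi (ha T hT)
      simp only [hi, hai, if_false, ite_self]
      apply Finset.sum_eq_zero
      intro E hE
      have : i ∉ E := fun h => hi (Finset.mem_powerset.mp hE h)
      simp [this]
  · simp only [am_mem3, am_inf3, hv2, if_false, if_true, ite_self, Finset.sum_const_zero, zero_add]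
    rw [← Finset.mul_sum]
    have : ∑ i, σ i = 0 := by
      simp only [hσ, Finset.sum_filter _ (fun T => s T), Finset.sum_filter (_ ∈ ·)]
      rw [Finset.sum_comm]
      rw [Finset.sum_congr rfl (g := fun T => 3 * s T), ← Finset.mul_sum, hs0, mul_zero]
      intro T hT
      rw [← Finset.sum_filter, Finset.sum_const, Finset.filter_mem_eq_inter, Finset.univ_inter,
        hS.1 T (Finset.mem_filter.mp hT).1]
      simp
    rw [this, mul_zero]

def amPt {n : ℕ} (i : Fin n) (b : Prop) [Decidable b] : AMPoint n :=
  if b then Sum.inr (Sum.inl i) else Sum.inl i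

theorem am_pt {n : ℕ} (T E : Finset (Fin n)) (hE : E ⊆ T) (i : Fin n) (b : Prop) [Decidable b] :
    amPt i b ∈ amBlock n T E ↔ i ∈ T ∧ (i ∈ E ↔ b) := by
  unfold amPt
  have := @hE i
  split_ifs with h
  · rw [am_mem2]; tauto
  · rw [am_mem1]; tauto

theorem am_pt_inf {n : ℕ} (i j : Fin n) (b : Prop) [Decidable b] :
    amPt i b ∈ amInf n j ↔ i = j := by
  unfold amPt
  split_ifs with h
  · rw [am_inf2]
  · rw [am_inf1]

theorem am_pt_ex {n : ℕ} (P : AMPoint n) :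
    (∃ (i : Fin n) (b : Bool), P = amPt i (b = true)) ∨ P = Sum.inr (Sum.inr ()) := by
  rcases P with i | i | u
  · exact Or.inl ⟨i, false, by simp [amPt]⟩
  · exact Or.inl ⟨i, true, by simp [amPt]⟩
  · exact Or.inr rfl

theorem am_card3 {n : ℕ} {a b c : Fin n} (hab : a ≠ b) (hac : a ≠ c) (hbc : b ≠ c)
    {E : Finset (Fin n)} (hE : E ⊆ {a, b, c}) :
    E.card = (if a ∈ E then 1 else 0) + (if b ∈ E then 1 else 0) + (if c ∈ E then 1 else 0) := by
  have h : E = ({a, b, c} : Finset (Fin n)).filter (· ∈ E) := by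
    ext i
    rw [Finset.mem_filter]
    exact ⟨fun h => ⟨hE h, h⟩, fun h => h.2⟩
  conv_lhs => rw [h]
  rw [Finset.card_filter, Finset.sum_insert (by simp [hab, hac]), Finset.sum_pair hbc, add_assoc]

theorem am_pair {n : ℕ} {S : Finset (Finset (Fin n))} (hS : IsSTS n S) (τ : Finset (Fin n) → Bool)
    (P Q : AMPoint n) (hPQ : P ≠ Q) : ∃! B, B ∈ amSTS n S τ ∧ P ∈ B ∧ Q ∈ B := by
  rcases am_pt_ex P with ⟨i, bi, rfl⟩ | rfl <;> rcases am_pt_ex Q with ⟨j, bj, rfl⟩ | rfl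
  · by_cases hij : i = j
    · subst hij
      refine ⟨amInf n i, ⟨am_mem.mpr (Or.inr ⟨i, rfl⟩), (am_pt_inf _ _ _).mpr rfl,
        (am_pt_inf _ _ _).mpr rfl⟩, ?_⟩
      rintro B ⟨hB, h1, h2⟩
      rcases am_mem.mp hB with ⟨T, hT, E, hE, -, rfl⟩ | ⟨k, rfl⟩
      · rw [am_pt _ _ hE] at h1 h2
        exfalso
        apply hPQ
        have : bi = bj := by
          rw [Bool.eq_iff_iff]; tauto
        rw [this]
      · rw [am_pt_inf] at h1
        rw [h1]
    · obtain ⟨T, hT, hi, hj⟩ := am_ex hS hij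
      have hcc : ((T.erase i).erase j).card = 1 := by
        rw [Finset.card_erase_of_mem (Finset.mem_erase.mpr ⟨Ne.symm hij, hj⟩),
          Finset.card_erase_of_mem hi, hS.1 T hT]
      obtain ⟨k, hk⟩ := Finset.card_eq_one.mp hcc
      have hk' : k ∈ (T.erase i).erase j := by rw [hk]; simp
      simp only [Finset.mem_erase] at hk'
      have hT' : T = {i, j, k} := by
        rw [← Finset.insert_erase hi, ← Finset.insert_erase (Finset.mem_erase.mpr ⟨Ne.symm hij, hj⟩),
          hk]
      have hik : i ≠ k := Ne.symm hk'.2.1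
      have hjk : j ≠ k := Ne.symm hk'.1
      let bk : Bool := xor (τ T) (xor bi bj)
      let E0 : Finset (Fin n) := T.filter (fun x => x = i ∧ bi = true ∨ x = j ∧ bj = true ∨
        x = k ∧ bk = true)
      have hE0 : E0 ⊆ T := Finset.filter_subset _ _
      have hi0 : i ∈ E0 ↔ bi = true := by
        simp [E0, hi, hij, hik]
      have hj0 : j ∈ E0 ↔ bj = true := by
        simp [E0, hj, Ne.symm hij, hjk]
      have hk0 : k ∈ E0 ↔ bk = true := by
        simp [E0, hk'.2.2, Ne.symm hik, Ne.symm hjk]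
      have hpar : ∀ E ⊆ T, (i ∈ E ↔ bi = true) → (j ∈ E ↔ bj = true) →
          ((if τ T then Odd E.card else Even E.card) ↔ (k ∈ E ↔ bk = true)) := by
        intro E hE h1 h2
        rw [hT'] at hE
        rw [am_card3 hij hik hjk hE]
        simp only [h1, h2, bk]
        by_cases hkE : k ∈ E <;> cases bi <;> cases bj <;> cases τ T <;> simp [hkE] <;> decide
      refine ⟨amBlock n T E0, ⟨am_mem.mpr (Or.inl ⟨T, hT, E0, hE0, (hpar E0 hE0 hi0 hj0).mpr hk0,
        rfl⟩), (am_pt _ _ hE0 _ _).mpr ⟨hi, hi0⟩, (am_pt _ _ hE0 _ _).mpr ⟨hj, hj0⟩⟩, ?_⟩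
      rintro B ⟨hB, h1, h2⟩
      rcases am_mem.mp hB with ⟨U, hU, E, hE, hp, rfl⟩ | ⟨l, rfl⟩
      · rw [am_pt _ _ hE] at h1 h2
        have hUT : U = T := am_uniq hS hij hU hT h1.1 h2.1 hi hj
        subst hUT
        have hkE := (hpar E hE h1.2 h2.2).mp hp
        have : E = E0 := by
          ext x
          by_cases hx : x ∈ U
          · have hx' := hx
            rw [hT'] at hx'
            simp only [Finset.mem_insert, Finset.mem_singleton] at hx'
            rcases hx' with rfl | rfl | rfl
            · rw [h1.2, hi0]
            · rw [h2.2, hj0]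
            · rw [hkE, hk0]
          · exact ⟨fun h => absurd (hE h) hx, fun h => absurd (hE0 h) hx⟩
        rw [this]
      · rw [am_pt_inf] at h1 h2
        exact absurd (h1.trans h2.symm) hij
  · refine ⟨amInf n i, ⟨am_mem.mpr (Or.inr ⟨i, rfl⟩), (am_pt_inf _ _ _).mpr rfl, am_inf3 _ _⟩, ?_⟩
    rintro B ⟨hB, h1, h2⟩
    rcases am_mem.mp hB with ⟨T, hT, E, hE, -, rfl⟩ | ⟨k, rfl⟩
    · exact absurd h2 (am_mem3 _ _ _)
    · rw [am_pt_inf] at h1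
      rw [h1]
  · refine ⟨amInf n j, ⟨am_mem.mpr (Or.inr ⟨j, rfl⟩), am_inf3 _ _, (am_pt_inf _ _ _).mpr rfl⟩, ?_⟩
    rintro B ⟨hB, h1, h2⟩
    rcases am_mem.mp hB with ⟨T, hT, E, hE, -, rfl⟩ | ⟨k, rfl⟩
    · exact absurd h1 (am_mem3 _ _ _)
    · rw [am_pt_inf] at h2
      rw [h2]
  · exact absurd rfl hPQ

theorem am_card {n : ℕ} {S : Finset (Finset (Fin n))} (hS : IsSTS n S) (τ : Finset (Fin n) → Bool)
    (B : Finset (AMPoint n)) (hB : B ∈ amSTS n S τ) : B.card = 3 := by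
  rcases am_mem.mp hB with ⟨T, hT, E, hE, -, rfl⟩ | ⟨k, rfl⟩
  · rw [amBlock, Finset.card_union_of_disjoint, Finset.card_image_of_injective,
      Finset.card_image_of_injective, Finset.card_sdiff_add_card_eq_card hE, hS.1 T hT]
    · intro a b h; simpa using h
    · intro a b h; simpa using h
    · rw [Finset.disjoint_left]
      intro x h1 h2
      simp only [Finset.mem_image] at h1 h2
      obtain ⟨a, _, rfl⟩ := h1
      obtain ⟨b, _, h⟩ := h2
      simp at h
  · simp [amInf]

theorem assmus_mattson_five_flow (n : ℕ) (hn : 49 ≤ n)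
    (S : Finset (Finset (Fin n))) (hS : IsSTS n S) (τ : Finset (Fin n) → Bool) :
    -- `S̄` is a Steiner triple system on `AMPoint n`
    ((∀ T ∈ amSTS n S τ, T.card = 3) ∧
      (∀ p : Finset (AMPoint n), p.card = 2 → ∃! T, T ∈ amSTS n S τ ∧ p ⊆ T)) ∧
    -- and `S̄` admits a 5-flow
    (∃ v : Finset (AMPoint n) → ℤ,
      (∀ T ∈ amSTS n S τ, v T ≠ 0 ∧ |v T| ≤ 4) ∧
      (∀ p : AMPoint n, ∑ T ∈ (amSTS n S τ).filter (fun T => p ∈ T), v T = 0)) := by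
  refine ⟨⟨fun T hT => am_card hS τ T hT, fun p hp => ?_⟩, am_flow hn hS τ⟩
  obtain ⟨P, Q, hPQ, rfl⟩ := Finset.card_eq_two.mp hp
  simpa only [Finset.insert_subset_iff, Finset.singleton_subset_iff] using am_pair hS τ P Q hPQ
end
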